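/- arXiv:1806.09263 — 6 statements merged into one kernel-verified Lean document; each statement's English description precedes it below -/
import Mathlib

section
/- The k-algebra homomorphism φ: D_n → E_n^! determined by a_{i,j} ↦ y_{i,j}^2 (1 ≤ i < j ≤ n) is well defined and injective. In particular, D_n is isomorphic to the subalgebra C_n of E_n^! generated by the elements y_{i,j}^2. -/
/- The quadratic dual Fomin–Kirillov algebra `E_n^!` over an algebraically
closed field `k` of characteristic zero, presented as a quotient of the free
algebra on generators `y_{i,j}` (for `1 ≤ i < j ≤ n`, realized here with
`0`-based indexing by the subtype of pairs `(i,j) : Fin n × Fin n` with `i < j`),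
with the convention `y_{j,i} = -y_{i,j}`. -/

noncomputable section

variable (k : Type) [Field k] [IsAlgClosed k] [CharZero k]

/-- Index set for the generators: pairs `(i,j)` with `i < j`. -/
abbrev FKIdx (n : ℕ) := {p : Fin n × Fin n // p.1 < p.2}

/-- The element `y_{i,j}` of the free algebra, with the convention
`y_{j,i} = -y_{i,j}` (and `y_{i,i} = 0`, which is never used). -/
def Ygen (n : ℕ) (i j : Fin n) : FreeAlgebra k (FKIdx n) :=
  if h : i < j then FreeAlgebra.ι k ⟨(i, j), h⟩
  else if h' : j < i then - FreeAlgebra.ι k ⟨(j, i), h'⟩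
  else 0

/-- The defining relations of `E_n^!`. -/
inductive FKRel (n : ℕ) : FreeAlgebra k (FKIdx n) → FreeAlgebra k (FKIdx n) → Prop
  | triple (i j l : Fin n) (hij : i ≠ j) (hjl : j ≠ l) (hil : i ≠ l) :
      FKRel n (Ygen k n i j * Ygen k n j l + Ygen k n j l * Ygen k n i l) 0
  | disj (i j s t : Fin n) (hij : i < j) (hst : s < t)
      (h1 : i ≠ s) (h2 : i ≠ t) (h3 : j ≠ s) (h4 : j ≠ t) :
      FKRel n (Ygen k n i j * Ygen k n s t + Ygen k n s t * Ygen k n i j) 0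

/-- The quadratic dual Fomin–Kirillov algebra `E_n^!`. -/
abbrev FKDual (n : ℕ) := RingQuot (FKRel k n)

/-- The generator `y_{i,j}` of `E_n^!`. -/
def yy (n : ℕ) (i j : Fin n) : FKDual k n :=
  RingQuot.mkAlgHom k (FKRel k n) (Ygen k n i j)

/-- Index set for the generators: pairs `(i,j)` with `i < j`. -/
abbrev DIdx (n : ℕ) := {p : Fin n × Fin n // p.1 < p.2}

/-- The generator `a_{i,j}` of the polynomial ring, with the convention
`a_{j,i} = a_{i,j}` (and `a_{i,i} = 0`, never used). -/
def Agen (n : ℕ) (i j : Fin n) : MvPolynomial (DIdx n) k :=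
  if h : i < j then MvPolynomial.X ⟨(i, j), h⟩
  else if h' : j < i then MvPolynomial.X ⟨(j, i), h'⟩
  else 0

/-- The defining relations of `D_n`. -/
def DRelSet (n : ℕ) : Set (MvPolynomial (DIdx n) k) :=
  {p | ∃ i j l : Fin n, i ≠ j ∧ j ≠ l ∧ i ≠ l ∧
    p = Agen k n i j * Agen k n j l - Agen k n i j * Agen k n i l}

/-- The commutative algebra `D_n`. -/
abbrev DAlg (n : ℕ) := MvPolynomial (DIdx n) k ⧸ Ideal.span (DRelSet k n)

/-- The generator `a_{i,j}` of `D_n`. -/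
def aa (n : ℕ) (i j : Fin n) : DAlg k n :=
  Ideal.Quotient.mk (Ideal.span (DRelSet k n)) (Agen k n i j)

/-! ### The commutative side -/

theorem aa_symm (K : Type) [Field K] (n : ℕ) (i j : Fin n) : aa K n i j = aa K n j i := by
  unfold aa Agen
  rcases lt_trichotomy i j with h | h | h
  · simp [h, h.not_gt]
  · subst h; rfl
  · simp [h, h.not_gt]

theorem aa_rel (K : Type) [Field K] (n : ℕ) (i j l : Fin n) (hij : i ≠ j) (hjl : j ≠ l)
    (hil : i ≠ l) : aa K n i j * aa K n j l = aa K n i j * aa K n i l := by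
  unfold aa
  rw [← map_mul, ← map_mul, Ideal.Quotient.eq]
  exact Ideal.subset_span ⟨i, j, l, hij, hjl, hil, rfl⟩

theorem aa_lt (K : Type) [Field K] (n : ℕ) (e : DIdx n) :
    aa K n e.1.1 e.1.2 =
      Ideal.Quotient.mk (Ideal.span (DRelSet K n)) (MvPolynomial.X e) := by
  unfold aa Agen
  rw [dif_pos e.2]

/-- Universal property of `D_n`. -/
theorem DAlg_lift (K : Type) [Field K] (n : ℕ) (B : Type) [CommRing B] [Algebra K B]
    (c : Fin n → Fin n → B) (hs : ∀ i j, c i j = c j i)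
    (hr : ∀ i j l, i ≠ j → j ≠ l → i ≠ l → c i j * c j l = c i j * c i l) :
    ∃ f : DAlg K n →ₐ[K] B, ∀ i j, i ≠ j → f (aa K n i j) = c i j := by
  let g : MvPolynomial (DIdx n) K →ₐ[K] B := MvPolynomial.aeval (fun e => c e.1.1 e.1.2)
  have hg : ∀ i j, i ≠ j → g (Agen K n i j) = c i j := by
    intro i j hij
    unfold Agen
    rcases lt_or_gt_of_ne hij with h | h
    · simp [h, g]
    · simp [h, h.not_gt, g, hs i j]
  refine ⟨Ideal.Quotient.liftₐ _ g ?_, ?_⟩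
  · intro x hx
    have : Ideal.span (DRelSet K n) ≤ RingHom.ker g := by
      rw [Ideal.span_le]
      rintro _ ⟨i, j, l, hij, hjl, hil, rfl⟩
      simp only [SetLike.mem_coe, RingHom.mem_ker, map_sub, map_mul]
      rw [hg i j hij, hg j l hjl, hg i l hil, hr i j l hij hjl hil, sub_self]
    exact this hx
  · intro i j hij
    rw [← hg i j hij]
    rfl

theorem DAlg_hom_ext (K : Type) [Field K] (n : ℕ) (B : Type) [Ring B] [Algebra K B]
    (f g : DAlg K n →ₐ[K] B) (h : ∀ i j, i < j → f (aa K n i j) = g (aa K n i j)) : f = g := by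
  apply Ideal.Quotient.algHom_ext
  apply MvPolynomial.algHom_ext
  intro e
  have := h e.1.1 e.1.2 e.2
  rw [aa_lt] at this
  exact this

/-! ### The noncommutative side -/

theorem ring_aux_sq {A : Type*} [Ring A] {a b : A} (h : a = -b) : a ^ 2 = b ^ 2 := by
  rw [h, neg_sq]

theorem ring_aux_neg {A : Type*} [Ring A] {a a' b : A} (h : a = -a')
    (h' : a' * b = b * a') : a * b = b * a := by
  rw [h, neg_mul, h', mul_neg]

theorem ring_aux_comm {A : Type*} [Ring A] {a b c : A} (h1 : a * b = -(b * c))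
    (h2 : c * b = -(b * a)) : a * b ^ 2 = b ^ 2 * a := by
  rw [pow_two, ← mul_assoc, h1, neg_mul, mul_assoc, h2, mul_neg, neg_neg, ← mul_assoc]

theorem ring_aux_flip {A : Type*} [Ring A] {a b b' c : A} (hb : b' = -b)
    (h : a * b' = -(b' * c)) : a * b = -(b * c) := by
  rw [hb, mul_neg, neg_mul] at h
  exact neg_injective h

theorem ring_aux_move {A : Type*} [Ring A] {a b c : A} (h1 : a * b = -(b * c)) :
    a ^ 2 * b = b * c ^ 2 := by
  rw [pow_two, mul_assoc, h1, mul_neg, ← mul_assoc, h1, neg_mul, neg_neg, mul_assoc, ← pow_two]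

theorem yy_neg (K : Type) [Field K] (n : ℕ) (i j : Fin n) : yy K n i j = - yy K n j i := by
  unfold yy
  rw [← map_neg]
  congr 1
  unfold Ygen
  rcases lt_trichotomy i j with h | h | h
  · simp [h, h.not_gt]
  · subst h; simp
  · simp [h, h.not_gt]

theorem yy_triple (K : Type) [Field K] (n : ℕ) (i j l : Fin n) (hij : i ≠ j) (hjl : j ≠ l)
    (hil : i ≠ l) : yy K n i j * yy K n j l = - (yy K n j l * yy K n i l) := by
  have := RingQuot.mkAlgHom_rel K (FKRel.triple (k := K) i j l hij hjl hil)
  rw [map_add, map_mul, map_mul, map_zero] at this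
  exact eq_neg_of_add_eq_zero_left this

theorem yy_disj (K : Type) [Field K] (n : ℕ) (i j s t : Fin n) (hij : i < j) (hst : s < t)
    (h1 : i ≠ s) (h2 : i ≠ t) (h3 : j ≠ s) (h4 : j ≠ t) :
    yy K n i j * yy K n s t = - (yy K n s t * yy K n i j) := by
  have := RingQuot.mkAlgHom_rel K (FKRel.disj (k := K) i j s t hij hst h1 h2 h3 h4)
  rw [map_add, map_mul, map_mul, map_zero] at this
  exact eq_neg_of_add_eq_zero_left this

theorem yy_sq_symm (K : Type) [Field K] (n : ℕ) (i j : Fin n) :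
    yy K n i j ^ 2 = yy K n j i ^ 2 := by
  exact ring_aux_sq (yy_neg K n i j)

theorem yy_comm_adj (K : Type) [Field K] (n : ℕ) (i j l : Fin n) (hij : i ≠ j) (hjl : j ≠ l)
    (hil : i ≠ l) : yy K n i j * yy K n j l ^ 2 = yy K n j l ^ 2 * yy K n i j := by
  have h1 := yy_triple K n i j l hij hjl hil
  have h2 := yy_triple K n i l j hil hjl.symm hij
  exact ring_aux_comm h1 (ring_aux_flip (yy_neg K n l j) h2)

theorem yy_comm (K : Type) [Field K] (n : ℕ) (i j s t : Fin n) (hij : i < j) (hst : s < t) :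
    yy K n i j * yy K n s t ^ 2 = yy K n s t ^ 2 * yy K n i j := by
  by_cases h3 : j = s
  · subst h3
    exact yy_comm_adj K n i j t hij.ne hst.ne (hij.trans hst).ne
  by_cases h2 : i = t
  · subst h2
    have := yy_comm_adj K n j i s hij.ne' hst.ne' (hst.trans hij).ne'
    rw [yy_sq_symm K n s i]
    exact ring_aux_neg (yy_neg K n i j) this
  by_cases h1 : i = s
  · subst h1
    by_cases h4 : j = t
    · subst h4; rw [pow_two, mul_assoc]
    · have := yy_comm_adj K n j i t hij.ne' hst.ne h4
      exact ring_aux_neg (yy_neg K n i j) this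
  by_cases h4 : j = t
  · subst h4
    have := yy_comm_adj K n i j s hij.ne hst.ne' h1
    rw [yy_sq_symm K n s j, this]
  have := yy_disj K n i j s t hij hst h1 h2 h3 h4
  exact ring_aux_comm this this

theorem yy_adjoin (K : Type) [Field K] (n : ℕ) :
    Algebra.adjoin K {z : FKDual K n | ∃ i j : Fin n, i < j ∧ z = yy K n i j} = ⊤ := by
  have h1 := congrArg (Subalgebra.map (RingQuot.mkAlgHom K (FKRel K n)))
    (FreeAlgebra.adjoin_range_ι K (FKIdx n))
  rw [AlgHom.map_adjoin, Algebra.map_top,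
    (AlgHom.range_eq_top _).2 (RingQuot.mkAlgHom_surjective K (FKRel K n))] at h1
  rw [← h1]
  congr 1
  ext z
  constructor
  · rintro ⟨i, j, hij, rfl⟩
    refine ⟨_, ⟨⟨(i, j), hij⟩, rfl⟩, ?_⟩
    simp [yy, Ygen, hij]
  · rintro ⟨_, ⟨⟨⟨i, j⟩, hij⟩, rfl⟩, rfl⟩
    refine ⟨i, j, hij, ?_⟩
    simp only at hij
    simp [yy, Ygen, hij]

theorem yy_sq_center (K : Type) [Field K] (n : ℕ) (i j : Fin n) (hij : i ≠ j) :
    yy K n i j ^ 2 ∈ Subalgebra.center K (FKDual K n) := by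
  wlog h : i < j generalizing i j
  · rw [yy_sq_symm]
    exact this j i hij.symm (lt_of_le_of_ne (not_lt.1 h) hij.symm)
  rw [Subalgebra.mem_center_iff]
  intro b
  have hb : b ∈ Algebra.adjoin K {z : FKDual K n | ∃ i j : Fin n, i < j ∧ z = yy K n i j} := by
    rw [yy_adjoin]; trivial
  have hle : Algebra.adjoin K {z : FKDual K n | ∃ i j : Fin n, i < j ∧ z = yy K n i j} ≤
      Subalgebra.centralizer K {yy K n i j ^ 2} := by
    rw [Algebra.adjoin_le_iff]
    rintro _ ⟨s, t, hst, rfl⟩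
    simp only [SetLike.mem_coe, Subalgebra.mem_centralizer_iff, Set.mem_singleton_iff,
      forall_eq]
    exact (yy_comm K n s t i j hst h).symm
  have := hle hb
  simp only [Subalgebra.mem_centralizer_iff, Set.mem_singleton_iff, forall_eq] at this
  exact this.symm

theorem exists_phi (K : Type) [Field K] (n : ℕ) :
    ∃ φ : DAlg K n →ₐ[K] FKDual K n, ∀ i j : Fin n, i ≠ j → φ (aa K n i j) = yy K n i j ^ 2 := by
  let c : Fin n → Fin n → Subalgebra.center K (FKDual K n) := fun i j =>
    if h : i ≠ j then ⟨yy K n i j ^ 2, yy_sq_center K n i j h⟩ else 0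
  have hc : ∀ i j, i ≠ j → (c i j : FKDual K n) = yy K n i j ^ 2 := by
    intro i j h
    simp [c, h]
  have hs : ∀ i j, c i j = c j i := by
    intro i j
    by_cases h : i = j
    · rw [h]
    · apply Subtype.ext
      rw [hc i j h, hc j i (Ne.symm h), yy_sq_symm]
  obtain ⟨f, hf⟩ := DAlg_lift K n (Subalgebra.center K (FKDual K n)) c hs (by
    intro i j l hij hjl hil
    apply Subtype.ext
    rw [MulMemClass.coe_mul, MulMemClass.coe_mul, hc i j hij, hc j l hjl, hc i l hil]
    have hcen := Subalgebra.mem_center_iff.1 (yy_sq_center K n j l hjl)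
    have hcen' := Subalgebra.mem_center_iff.1 (yy_sq_center K n i l hil)
    have h1 := yy_triple K n l j i hjl.symm hij.symm hil.symm
    have h2 := yy_triple K n l i j hil.symm hij hjl.symm
    have h3 : yy K n l j ^ 2 * yy K n j i = yy K n j i * yy K n l i ^ 2 := ring_aux_move h1
    rw [yy_sq_symm K n j l, yy_sq_symm K n i l, yy_sq_symm K n i j]
    rw [yy_sq_symm K n i l] at hcen'
    rw [yy_sq_symm K n j l] at hcen
    rw [hcen, pow_two (yy K n j i), ← mul_assoc, h3, mul_assoc, ← hcen', ← mul_assoc])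
  refine ⟨(Subalgebra.val _).comp f, ?_⟩
  intro i j hij
  rw [AlgHom.comp_apply, hf i j hij]
  exact hc i j hij

/-! ### Clifford representations -/

theorem exists_psi (K : Type) [Field K] [IsAlgClosed K] [CharZero K] (n : ℕ)
    (c : Fin n → Fin n → K) (hs : ∀ i j, c i j = c j i)
    (hr : ∀ i j l, i ≠ j → j ≠ l → i ≠ l → c i j * c j l = c i j * c i l) :
    ∃ ψ : FKDual K n →ₐ[K]
        CliffordAlgebra (QuadraticMap.weightedSumSquares K (fun _ : Fin n => (1 : K))),
      ∀ i j, i < j → ψ (yy K n i j) ^ 2 = algebraMap K _ (c i j) := by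
  set Q : QuadraticForm K (Fin n → K) :=
    QuadraticMap.weightedSumSquares K (fun _ : Fin n => (1 : K)) with hQ
  have hsq : ∀ x : K, ∃ z : K, z ^ 2 = x / 2 := fun x =>
    IsAlgClosed.exists_pow_nat_eq _ two_pos
  choose σ hσ using hsq
  have hσ0 : σ 0 = 0 := by
    have := hσ 0
    simpa using this
  let v : Fin n → Fin n → (Fin n → K) := fun i j => Pi.single i 1 - Pi.single j 1
  have hQv : ∀ x y : Fin n → K, QuadraticMap.polar Q x y = 2 * ∑ i, x i * y i := by
    intro x y
    simp only [QuadraticMap.polar, hQ, QuadraticMap.weightedSumSquares_apply, Pi.add_apply,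
      one_smul, Finset.mul_sum, ← Finset.sum_sub_distrib]
    refine Finset.sum_congr rfl fun i _ => ?_
    ring
  have hdot : ∀ (x : Fin n → K) (i j : Fin n), ∑ l, x l * v i j l = x i - x j := by
    intro x i j
    simp [v, mul_sub, Finset.sum_sub_distrib, Pi.single_apply]
  have hQQ : ∀ i j, i ≠ j → Q (v i j) = 2 := by
    intro i j hij
    have : Q (v i j) = ∑ l, v i j l * v i j l := by
      simp [hQ, QuadraticMap.weightedSumSquares_apply]
    rw [this, hdot]
    simp [v, Pi.single_apply, hij, hij.symm]
    norm_num
  let Y : Fin n → Fin n → CliffordAlgebra Q := fun i j => σ (c i j) • CliffordAlgebra.ι Q (v i j)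
  have hYneg : ∀ i j, Y i j = - Y j i := by
    intro i j
    simp only [Y]
    rw [hs i j, ← smul_neg, ← map_neg]
    simp [v]
  let g : FreeAlgebra K (FKIdx n) →ₐ[K] CliffordAlgebra Q :=
    FreeAlgebra.lift K (fun e => Y e.1.1 e.1.2)
  have hg : ∀ i j, i ≠ j → g (Ygen K n i j) = Y i j := by
    intro i j hij
    unfold Ygen
    rcases lt_or_gt_of_ne hij with h | h
    · simp [h, g]
    · simp [h, h.not_gt, g, hYneg i j]
  have hw : ∀ ⦃x y⦄, FKRel K n x y → g x = g y := by
    intro x y hxy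
    induction hxy with
    | triple i j l hij hjl hil =>
      rw [map_add, map_mul, map_mul, map_zero, hg i j hij, hg j l hjl, hg i l hil]
      by_cases h0 : c j l = 0
      · simp [Y, h0, hσ0]
      · have hcc : c i j = c i l := by
          have := hr j l i hjl hil.symm hij.symm
          have := mul_left_cancel₀ h0 this
          rw [hs i j, hs i l, this]
        have hv : v i l = v i j + v j l := by simp [v]
        simp only [Y, hcc, hv, map_add, smul_mul_smul_comm]
        rw [mul_comm (σ (c j l)), ← smul_add, mul_add, CliffordAlgebra.ι_sq_scalar, hQQ j l hjl,
          ← add_assoc, CliffordAlgebra.ι_mul_ι_add_swap, hQv, hdot, ← map_add]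
        have : (2 * (v i j j - v i j l) + 2 : K) = 0 := by
          simp [v, Pi.single_apply, hij, hij.symm, hjl, hjl.symm, hil, hil.symm]
        rw [this]; simp
    | disj i j s t hij hst h1 h2 h3 h4 =>
      rw [map_add, map_mul, map_mul, map_zero, hg i j hij.ne, hg s t hst.ne]
      simp only [Y, smul_mul_smul_comm]
      rw [mul_comm (σ (c s t)), ← smul_add, CliffordAlgebra.ι_mul_ι_add_swap, hQv, hdot]
      simp [v, Pi.single_apply, h1, h2, h3, h4, h1.symm, h2.symm, h3.symm, h4.symm]
  refine ⟨RingQuot.liftAlgHom K ⟨g, hw⟩, ?_⟩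
  intro i j hij
  have : RingQuot.liftAlgHom K ⟨g, hw⟩ (yy K n i j) = Y i j := by
    unfold yy
    rw [RingQuot.liftAlgHom_mkAlgHom_apply, hg i j hij.ne]
  rw [this, pow_two]
  simp only [Y, smul_mul_smul_comm]
  rw [CliffordAlgebra.ι_sq_scalar, hQQ i j hij.ne, ← pow_two, hσ, Algebra.smul_def, ← map_mul]
  congr 1
  field_simp

/-- Every character of `D_n` kills the kernel of `φ`. -/
theorem character_kernel (K : Type) [Field K] [IsAlgClosed K] [CharZero K] (n : ℕ)
    (φ : DAlg K n →ₐ[K] FKDual K n) (hφ : ∀ i j : Fin n, i ≠ j → φ (aa K n i j) = yy K n i j ^ 2)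
    (χ : DAlg K n →ₐ[K] K) (d : DAlg K n) (hd : φ d = 0) : χ d = 0 := by
  obtain ⟨ψ, hψ⟩ := exists_psi K n (fun i j => χ (aa K n i j))
    (fun i j => by rw [aa_symm]) (fun i j l hij hjl hil => by
      rw [← map_mul, ← map_mul, aa_rel K n i j l hij hjl hil])
  have hext : ψ.comp φ = (Algebra.ofId K _).comp χ := by
    apply DAlg_hom_ext
    intro i j hij
    rw [AlgHom.comp_apply, AlgHom.comp_apply, hφ i j hij.ne, map_pow, hψ i j hij]
    rfl
  have h := DFunLike.congr_fun hext d
  rw [AlgHom.comp_apply, AlgHom.comp_apply, hd, map_zero] at h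
  have hinv : Invertible (2 : K) := invertibleOfNonzero two_ne_zero
  exact (map_eq_zero_iff _ (FaithfulSMul.algebraMap_injective K
    (CliffordAlgebra (QuadraticMap.weightedSumSquares K (fun _ : Fin n => (1 : K)))))).1 h.symm

/-! ### Points separate the elements of `D_n` -/

/-- Set partitions of `Fin n`, encoded by the map sending an element to the minimum of its block. -/
abbrev PartMap (n : ℕ) := {ρ : Fin n → Fin n // (∀ v, ρ v ≤ v) ∧ ∀ v, ρ (ρ v) = ρ v}

/-- The monomial of the star forest attached to a partition. -/
def starProd (K : Type) [Field K] (n : ℕ) (ρ : Fin n → Fin n) : DAlg K n :=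
  ∏ v, if ρ v = v then 1 else aa K n (ρ v) v

open Classical in
/-- A chosen edge inside the block with minimum `b` (zero if the block is a singleton). -/
def blockVar (K : Type) [Field K] (n : ℕ) (ρ : Fin n → Fin n) (b : Fin n) : DAlg K n :=
  if h : ∃ w, w ≠ b ∧ ρ w = b then aa K n b h.choose else 0

theorem mul_eq_of_dvd {A : Type*} [CommRing A] {F a x y : A} (h : a ∣ F) (h' : a * x = a * y) :
    F * x = F * y := by
  obtain ⟨r, rfl⟩ := h
  rw [mul_right_comm, h', mul_right_comm]

theorem aa_dvd_starProd (K : Type) [Field K] (n : ℕ) (ρ : Fin n → Fin n) (v : Fin n)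
    (hv : ρ v ≠ v) : aa K n (ρ v) v ∣ starProd K n ρ := by
  have := Finset.dvd_prod_of_mem (fun v => if ρ v = v then 1 else aa K n (ρ v) v)
    (Finset.mem_univ v)
  rw [if_neg hv] at this
  exact this

/-- Replace an endpoint by the minimum of its block. -/
theorem starProd_move (K : Type) [Field K] (n : ℕ) (ρ : Fin n → Fin n) (i j : Fin n)
    (hij : i ≠ j) (hj : ρ i ≠ j) :
    starProd K n ρ * aa K n i j = starProd K n ρ * aa K n (ρ i) j := by
  by_cases h : ρ i = i
  · rw [h]
  · refine mul_eq_of_dvd (aa_dvd_starProd K n ρ i h) ?_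
    exact aa_rel K n (ρ i) i j h hij hj

theorem starProd_star (K : Type) [Field K] (n : ℕ) (ρ : Fin n → Fin n) (b u w : Fin n)
    (hu : ρ u = b) (hw : ρ w = b) (hub : u ≠ b) (hwb : w ≠ b) :
    starProd K n ρ * aa K n b u = starProd K n ρ * aa K n b w := by
  by_cases h : u = w
  · rw [h]
  · have h1 := starProd_move K n ρ u w h (by rw [hu]; exact hwb.symm)
    have h2 := starProd_move K n ρ w u (Ne.symm h) (by rw [hw]; exact hub.symm)
    rw [hu] at h1
    rw [hw] at h2
    rw [← h1, ← h2, aa_symm]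

theorem starProd_inner (K : Type) [Field K] (n : ℕ) (ρ : Fin n → Fin n)
    (hρ : ∀ v, ρ (ρ v) = ρ v) (i j : Fin n) (hij : i ≠ j) (h : ρ i = ρ j) :
    starProd K n ρ * aa K n i j = starProd K n ρ * blockVar K n ρ (ρ i) := by
  -- reduce to an edge through the minimum
  have key : ∀ u, u ≠ ρ i → ρ u = ρ i →
      starProd K n ρ * aa K n (ρ i) u = starProd K n ρ * blockVar K n ρ (ρ i) := by
    intro u hu1 hu2
    have hex : ∃ w, w ≠ ρ i ∧ ρ w = ρ i := ⟨u, hu1, hu2⟩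
    unfold blockVar
    rw [dif_pos hex]
    exact starProd_star K n ρ (ρ i) u _ hu2 hex.choose_spec.2 hu1 hex.choose_spec.1
  by_cases hj : ρ i = j
  · rw [aa_symm]
    have := key i (by rw [hj]; exact hij) rfl
    rw [hj] at this ⊢
    exact this
  · rw [starProd_move K n ρ i j hij hj]
    exact key j (Ne.symm hj) h.symm

/-- Merge the block of `c` into the block of `b`. -/
def mergeMap (n : ℕ) (ρ : Fin n → Fin n) (b c : Fin n) : Fin n → Fin n :=
  fun v => if ρ v = c then b else ρ v

theorem mul_prod_congr {A ι : Type*} [CommRing A] (s : Finset ι) (x : A) (f g : ι → A)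
    (h : ∀ i ∈ s, x * f i = x * g i) : x * ∏ i ∈ s, f i = x * ∏ i ∈ s, g i := by
  classical
  induction s using Finset.induction_on with
  | empty => simp
  | insert a s ha ih =>
    rw [Finset.prod_insert ha, Finset.prod_insert ha, ← mul_assoc,
      h a (Finset.mem_insert_self a s), mul_right_comm,
      ih (fun i hi => h i (Finset.mem_insert_of_mem hi)), mul_right_comm, mul_assoc]

theorem starProd_merge (K : Type) [Field K] (n : ℕ) (ρ : Fin n → Fin n) (b c : Fin n)
    (hb : ρ b = b) (hc : ρ c = c) (hbc : b ≠ c) :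
    starProd K n ρ * aa K n b c = starProd K n (mergeMap n ρ b c) := by
  unfold starProd
  rw [← Finset.mul_prod_erase Finset.univ _ (Finset.mem_univ c),
    ← Finset.mul_prod_erase Finset.univ
      (fun v => if mergeMap n ρ b c v = v then 1 else aa K n (mergeMap n ρ b c v) v)
      (Finset.mem_univ c)]
  have hm : mergeMap n ρ b c c = b := by simp [mergeMap, hc]
  rw [if_pos hc, one_mul, hm, if_neg hbc, mul_comm]
  apply mul_prod_congr
  intro v hv
  have hvc : v ≠ c := (Finset.mem_erase.1 hv).1
  by_cases h : ρ v = c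
  · have hm' : mergeMap n ρ b c v = b := by simp [mergeMap, h]
    have hbv : b ≠ v := by
      rintro rfl
      exact hbc (hb.symm.trans h)
    rw [hm', h, if_neg hvc.symm, if_neg hbv]
    exact aa_rel K n b c v hbc hvc.symm hbv
  · have hm' : mergeMap n ρ b c v = ρ v := by simp [mergeMap, h]
    rw [hm']

theorem mul_aeval_congr {K A σ : Type*} [CommRing K] [CommRing A] [Algebra K A] (F : A)
    (x y : σ → A) (h : ∀ b, F * x b = F * y b) (p : MvPolynomial σ K) :
    F * MvPolynomial.aeval x p = F * MvPolynomial.aeval y p := by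
  induction p using MvPolynomial.induction_on with
  | C a => simp
  | add p q hp hq => rw [map_add, map_add, mul_add, mul_add, hp, hq]
  | mul_X p b hp =>
    rw [map_mul, map_mul, MvPolynomial.aeval_X, MvPolynomial.aeval_X, ← mul_assoc, hp,
      mul_right_comm, h b, mul_right_comm, mul_assoc]

theorem term_mul_aa (K : Type) [Field K] (n : ℕ) (ρ : PartMap n) (p : MvPolynomial (Fin n) K)
    (i j : Fin n) (hij : i ≠ j) :
    ∃ (ρ' : PartMap n) (p' : MvPolynomial (Fin n) K),
      starProd K n ρ.1 * MvPolynomial.aeval (blockVar K n ρ.1) p * aa K n i j =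
        starProd K n ρ'.1 * MvPolynomial.aeval (blockVar K n ρ'.1) p' := by
  obtain ⟨ρ, hle, hid⟩ := ρ
  dsimp only
  by_cases h : ρ i = ρ j
  · refine ⟨⟨ρ, hle, hid⟩, p * MvPolynomial.X (ρ i), ?_⟩
    rw [mul_right_comm, starProd_inner K n ρ hid i j hij h, map_mul, MvPolynomial.aeval_X]
    ring
  · wlog hlt : ρ i < ρ j generalizing i j
    · rw [aa_symm]
      exact this j i hij.symm (Ne.symm h) (lt_of_le_of_ne (not_lt.1 hlt) (Ne.symm h))
    have hid' : ∀ v, mergeMap n ρ (ρ i) (ρ j) (mergeMap n ρ (ρ i) (ρ j) v) =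
        mergeMap n ρ (ρ i) (ρ j) v := by
      intro v
      unfold mergeMap
      by_cases hv : ρ v = ρ j
      · simp [hv, hid, h]
      · simp [hv, hid]
    refine ⟨⟨mergeMap n ρ (ρ i) (ρ j), ?_, hid'⟩, ?_⟩
    · intro v
      unfold mergeMap
      split_ifs with hv
      · exact (hlt.le.trans hv.symm.le).trans (hle v)
      · exact hle v
    · have e1 : starProd K n ρ * aa K n i j = starProd K n (mergeMap n ρ (ρ i) (ρ j)) := by
        rw [starProd_move K n ρ i j hij (by rintro rfl; exact h (hid i).symm), aa_symm,
          starProd_move K n ρ j (ρ i) (by rintro rfl; exact h (hid i).symm) (Ne.symm h), aa_symm]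
        exact starProd_merge K n ρ (ρ i) (ρ j) (hid i) (hid j) h
      classical
      let y : Fin n → MvPolynomial (Fin n) K := fun b =>
        if ∃ w, w ≠ b ∧ ρ w = b then MvPolynomial.X (mergeMap n ρ (ρ i) (ρ j) b) else 0
      refine ⟨MvPolynomial.aeval y p, ?_⟩
      rw [mul_right_comm, e1, ← AlgHom.comp_apply, MvPolynomial.comp_aeval]
      apply mul_aeval_congr
      intro b
      by_cases hb : ∃ w, w ≠ b ∧ ρ w = b
      · have hy : y b = MvPolynomial.X (mergeMap n ρ (ρ i) (ρ j) b) := if_pos hb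
        rw [hy, MvPolynomial.aeval_X]
        conv_lhs => unfold blockVar
        rw [dif_pos hb]
        refine starProd_inner K n _ hid' b _ hb.choose_spec.1.symm ?_
        have h2 : ρ hb.choose = b := hb.choose_spec.2
        have h3 : ρ b = ρ hb.choose := by
          conv_lhs => rw [← h2]
          rw [hid]
        unfold mergeMap
        rw [h3]
      · have hy : y b = 0 := if_neg hb
        rw [hy, map_zero]
        unfold blockVar
        rw [dif_neg hb]

theorem exists_decomp (K : Type) [Field K] (n : ℕ) (d : DAlg K n) :
    ∃ p : PartMap n → MvPolynomial (Fin n) K,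
      d = ∑ ρ, starProd K n ρ.1 * MvPolynomial.aeval (blockVar K n ρ.1) (p ρ) := by
  classical
  let L : (PartMap n → MvPolynomial (Fin n) K) →ₗ[K] DAlg K n :=
    ∑ ρ : PartMap n, (LinearMap.mulLeft K (starProd K n ρ.1)).comp
      ((MvPolynomial.aeval (blockVar K n ρ.1)).toLinearMap.comp (LinearMap.proj ρ))
  have hL : ∀ p, L p = ∑ ρ, starProd K n ρ.1 * MvPolynomial.aeval (blockVar K n ρ.1) (p ρ) := by
    intro p
    simp [L, LinearMap.sum_apply]
  have hsingle : ∀ (ρ : PartMap n) (q : MvPolynomial (Fin n) K),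
      starProd K n ρ.1 * MvPolynomial.aeval (blockVar K n ρ.1) q ∈ LinearMap.range L := by
    intro ρ q
    refine ⟨Pi.single ρ q, ?_⟩
    rw [hL, Finset.sum_eq_single ρ]
    · simp
    · intro σ _ hσ
      simp [Pi.single_eq_of_ne hσ]
    · simp
  have hmul : ∀ x ∈ LinearMap.range L, ∀ i j, i ≠ j → x * aa K n i j ∈ LinearMap.range L := by
    rintro _ ⟨p, rfl⟩ i j hij
    rw [hL, Finset.sum_mul]
    refine Submodule.sum_mem _ fun ρ _ => ?_
    obtain ⟨ρ', p', h⟩ := term_mul_aa K n ρ (p ρ) i j hij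
    rw [h]
    exact hsingle ρ' p'
  suffices h : d ∈ LinearMap.range L by
    obtain ⟨p, hp⟩ := h
    exact ⟨p, by rw [← hL, hp]⟩
  obtain ⟨q, rfl⟩ := Ideal.Quotient.mk_surjective d
  induction q using MvPolynomial.induction_on with
  | C a =>
    have := hsingle ⟨id, fun v => le_rfl, fun v => rfl⟩ (MvPolynomial.C a)
    have h1 : starProd K n id = 1 := by simp [starProd]
    rw [h1, one_mul, MvPolynomial.aeval_C] at this
    exact this
  | add p q hp hq =>
    rw [map_add]
    exact Submodule.add_mem _ hp hq
  | mul_X p e hp =>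
    rw [map_mul, ← aa_lt]
    exact hmul _ hp _ _ e.2.ne

/-- The number of pairs in a common block. -/
def pairCount (n : ℕ) (ρ : Fin n → Fin n) : ℕ :=
  (Finset.univ.filter fun q : Fin n × Fin n => ρ q.1 = ρ q.2).card

theorem part_order (n : ℕ) (ρ σ : PartMap n) (h : ∀ v, σ.1 (ρ.1 v) = σ.1 v) (hne : ρ ≠ σ) :
    pairCount n ρ.1 < pairCount n σ.1 := by
  have hsub : (Finset.univ.filter fun q : Fin n × Fin n => ρ.1 q.1 = ρ.1 q.2) ⊆
      Finset.univ.filter fun q : Fin n × Fin n => σ.1 q.1 = σ.1 q.2 := by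
    intro q hq
    simp only [Finset.mem_filter, Finset.mem_univ, true_and] at hq ⊢
    rw [← h q.1, ← h q.2, hq]
  refine Finset.card_lt_card (hsub.ssubset_of_ne fun heq => hne ?_)
  apply Subtype.ext
  funext v
  have h1 : ρ.1 (σ.1 v) = ρ.1 v := by
    have : (σ.1 v, v) ∈ Finset.univ.filter fun q : Fin n × Fin n => ρ.1 q.1 = ρ.1 q.2 := by
      rw [heq]
      simp [σ.2.2]
    simpa using this
  apply le_antisymm
  · rw [← h1]
    exact ρ.2.1 _
  · rw [← h v]
    exact σ.2.1 _

/-- The characters of `D_n` separate its elements. -/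
theorem characters_separate (K : Type) [Field K] [CharZero K] (n : ℕ) (d : DAlg K n)
    (hd : ∀ χ : DAlg K n →ₐ[K] K, χ d = 0) : d = 0 := by
  classical
  obtain ⟨p, hp⟩ := exists_decomp K n d
  let T : PartMap n → DAlg K n := fun ρ =>
    starProd K n ρ.1 * MvPolynomial.aeval (blockVar K n ρ.1) (p ρ)
  have hT : ∀ N, ∀ σ : PartMap n, pairCount n σ.1 = N → T σ = 0 := by
    intro N
    induction N using Nat.strong_induction_on with
    | _ N ih =>
    intro σ hσN
    let q : MvPolynomial (Fin n) K := MvPolynomial.aeval (fun b =>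
      if ∃ w, w ≠ b ∧ σ.1 w = b then (MvPolynomial.X b : MvPolynomial (Fin n) K) else 0) (p σ)
    have hq : MvPolynomial.aeval (blockVar K n σ.1) (p σ) =
        MvPolynomial.aeval (blockVar K n σ.1) q := by
      simp only [q]
      rw [← AlgHom.comp_apply, MvPolynomial.comp_aeval]
      congr 2
      funext b
      by_cases hb : ∃ w, w ≠ b ∧ σ.1 w = b
      · rw [if_pos hb, MvPolynomial.aeval_X]
      · rw [if_neg hb, map_zero]
        unfold blockVar
        rw [dif_neg hb]
    let P : MvPolynomial (Fin n) K :=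
      ∏ v, if σ.1 v = v then 1 else MvPolynomial.X (σ.1 v)
    have hP : P ≠ 0 := by
      refine Finset.prod_ne_zero_iff.2 fun v _ => ?_
      split_ifs
      · exact one_ne_zero
      · exact MvPolynomial.X_ne_zero _
    have hPq : P * q = 0 := by
      apply MvPolynomial.funext
      intro c
      rw [map_zero]
      obtain ⟨χ, hχ⟩ := DAlg_lift K n K
        (fun i j => if σ.1 i = σ.1 j then c (σ.1 i) else 0)
        (by
          intro i j
          by_cases h : σ.1 i = σ.1 j
          · simp [h]
          · simp [h, Ne.symm h])
        (by
          intro i j l _ _ _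
          by_cases h : σ.1 i = σ.1 j
          · simp [h]
          · simp [h])
      have h0 := hd χ
      rw [hp, map_sum, Finset.sum_eq_single σ] at h0
      · rw [map_mul] at h0
        have e1 : χ (starProd K n σ.1) = MvPolynomial.eval c P := by
          unfold starProd
          simp only [P]
          rw [map_prod, map_prod]
          refine Finset.prod_congr rfl fun v _ => ?_
          by_cases hv : σ.1 v = v
          · simp [hv]
          · rw [if_neg hv, if_neg hv, hχ _ _ hv, σ.2.2, if_pos rfl, MvPolynomial.eval_X]
        have e2 : χ (MvPolynomial.aeval (blockVar K n σ.1) (p σ)) = MvPolynomial.eval c q := by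
          simp only [q]
          rw [← AlgHom.comp_apply, MvPolynomial.comp_aeval, ← MvPolynomial.coe_aeval_eq_eval]
          change _ = MvPolynomial.aeval c _
          rw [← AlgHom.comp_apply, MvPolynomial.comp_aeval]
          congr 2
          funext b
          by_cases hb : ∃ w, w ≠ b ∧ σ.1 w = b
          · rw [if_pos hb, MvPolynomial.aeval_X]
            unfold blockVar
            rw [dif_pos hb, hχ _ _ hb.choose_spec.1.symm]
            have h2 : σ.1 hb.choose = b := hb.choose_spec.2
            have h3 : σ.1 b = b := by
              conv_lhs => rw [← h2]
              rw [σ.2.2, h2]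
            rw [h2, h3, if_pos rfl]
          · rw [if_neg hb, map_zero]
            unfold blockVar
            rw [dif_neg hb, map_zero]
        rw [map_mul, ← e1, ← e2, h0]
      · intro ρ _ hne
        by_cases hall : ∀ v, σ.1 (ρ.1 v) = σ.1 v
        · have hlt := part_order n ρ σ hall hne
          rw [hσN] at hlt
          have : T ρ = 0 := ih _ hlt ρ rfl
          change χ (T ρ) = 0
          rw [this, map_zero]
        · push Not at hall
          obtain ⟨v, hv⟩ := hall
          have hv' : ρ.1 v ≠ v := fun h => hv (by rw [h])
          obtain ⟨r, hr⟩ := aa_dvd_starProd K n ρ.1 v hv'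
          rw [hr, map_mul, map_mul, hχ _ _ hv', if_neg hv, zero_mul, zero_mul]
      · intro h
        exact absurd (Finset.mem_univ σ) h
    have hq0 : q = 0 := (mul_eq_zero.1 hPq).resolve_left hP
    change starProd K n σ.1 * MvPolynomial.aeval (blockVar K n σ.1) (p σ) = 0
    rw [hq, hq0, map_zero, mul_zero]
  rw [hp]
  exact Finset.sum_eq_zero fun ρ _ => hT _ ρ rfl

/-- the `k`-algebra homomorphism `φ : D_n → E_n^!` with
`φ(a_{i,j}) = y_{i,j}^2` is well defined and injective; in particular `D_n` is
isomorphic to the subalgebra `C_n` of `E_n^!` generated by the `y_{i,j}^2`. -/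
theorem DAlg_to_FKDual_injective (n : ℕ) (hn : 2 ≤ n) :
    ∃ φ : DAlg k n →ₐ[k] FKDual k n,
      (∀ i j : Fin n, i < j → φ (aa k n i j) = (yy k n i j) ^ 2) ∧
      Function.Injective φ ∧
      Nonempty (DAlg k n ≃ₐ[k]
        (Algebra.adjoin k
          {z : FKDual k n | ∃ i j : Fin n, i < j ∧ z = (yy k n i j) ^ 2})) := by
  obtain ⟨φ, hφ⟩ := exists_phi k n
  have hinj : Function.Injective φ := by
    rw [injective_iff_map_eq_zero]
    intro d hd
    exact characters_separate k n d fun χ => character_kernel k n φ hφ χ d hd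
  refine ⟨φ, fun i j hij => hφ i j hij.ne, hinj, ?_⟩
  have hrange : φ.range =
      Algebra.adjoin k {z : FKDual k n | ∃ i j : Fin n, i < j ∧ z = (yy k n i j) ^ 2} := by
    have h1 : φ.range = (φ.comp (Ideal.Quotient.mkₐ k (Ideal.span (DRelSet k n)))).range := by
      rw [AlgHom.range_comp, (AlgHom.range_eq_top _).2 (Ideal.Quotient.mkₐ_surjective _ _),
        Algebra.map_top]
    rw [h1, ← Algebra.map_top, ← MvPolynomial.adjoin_range_X, AlgHom.map_adjoin]
    congr 1
    ext z
    constructor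
    · rintro ⟨_, ⟨e, rfl⟩, rfl⟩
      refine ⟨e.1.1, e.1.2, e.2, ?_⟩
      rw [← hφ _ _ e.2.ne, aa_lt]
      rfl
    · rintro ⟨i, j, hij, rfl⟩
      refine ⟨_, ⟨⟨(i, j), hij⟩, rfl⟩, ?_⟩
      rw [← hφ _ _ hij.ne]
      exact congrArg φ (aa_lt k n ⟨(i, j), hij⟩).symm
  exact ⟨(AlgEquiv.ofInjective φ hinj).trans (Subalgebra.equivOfEq _ _ hrange)⟩

end
end

section
/- Every monomial in E_n^! is nonzero: for any finite (possibly repeating) list of pairs (i_1,j_1), …, (i_w,j_w) with 1 ≤ i_s < j_s ≤ n, the product y_{i_1,j_1} y_{i_2,j_2} ⋯ y_{i_w,j_w} is a nonzero element of E_n^!. -/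
/- The quadratic dual Fomin–Kirillov algebra `E_n^!` over an algebraically
closed field `k` of characteristic zero, presented as a quotient of the free
algebra on generators `y_{i,j}` (for `1 ≤ i < j ≤ n`, realized here with
`0`-based indexing by the subtype of pairs `(i,j) : Fin n × Fin n` with `i < j`),
with the convention `y_{j,i} = -y_{i,j}`. -/

noncomputable section

variable (k : Type) [Field k] [IsAlgClosed k] [CharZero k]

/-- The quadratic form `∑ v_i ^ 2`. -/
def sumSqForm (n : ℕ) : QuadraticForm k (Fin n → k) :=
  QuadraticMap.weightedSumSquares k (fun _ : Fin n => (1 : k))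

/-- The standard generators of the Clifford algebra. -/
def cliffE (n : ℕ) (i : Fin n) : CliffordAlgebra (sumSqForm k n) :=
  CliffordAlgebra.ι (sumSqForm k n) (Pi.single i 1)

theorem cliffE_sq (n : ℕ) (i : Fin n) : cliffE k n i * cliffE k n i = 1 := by
  unfold cliffE
  rw [CliffordAlgebra.ι_sq_scalar]
  have : sumSqForm k n (Pi.single i 1) = 1 := by
    simp [sumSqForm, QuadraticMap.weightedSumSquares_apply, Pi.single_apply]
  rw [this, map_one]

theorem cliffE_anti (n : ℕ) (i j : Fin n) (h : i ≠ j) :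
    cliffE k n i * cliffE k n j = - (cliffE k n j * cliffE k n i) := by
  rw [eq_neg_iff_add_eq_zero]
  unfold cliffE
  rw [CliffordAlgebra.ι_mul_ι_add_swap]
  have : QuadraticMap.polar (sumSqForm k n) (Pi.single i 1) (Pi.single j 1) = 0 := by
    unfold QuadraticMap.polar sumSqForm
    simp only [QuadraticMap.weightedSumSquares_apply, ← Finset.sum_sub_distrib]
    apply Finset.sum_eq_zero
    intro x _
    by_cases hx : x = i
    · subst hx; simp [Pi.single_apply, h]
    · simp [Pi.single_apply, hx]
  rw [this, map_zero]

/-- The map from the free algebra: `y_{i,j} ↦ e_i - e_j`. -/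
def freeToCliff (n : ℕ) : FreeAlgebra k (FKIdx n) →ₐ[k] CliffordAlgebra (sumSqForm k n) :=
  FreeAlgebra.lift k (fun p : FKIdx n => cliffE k n p.1.1 - cliffE k n p.1.2)

theorem freeToCliff_Ygen (n : ℕ) (i j : Fin n) :
    freeToCliff k n (Ygen k n i j) = cliffE k n i - cliffE k n j := by
  unfold Ygen freeToCliff
  split_ifs with h h'
  · simp
  · simp
  · have : i = j := le_antisymm (not_lt.mp h') (not_lt.mp h)
    simp [this]

theorem freeToCliff_rel (n : ℕ) ⦃x y : FreeAlgebra k (FKIdx n)⦄ (h : FKRel k n x y) :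
    freeToCliff k n x = freeToCliff k n y := by
  cases h with
  | triple i j l hij hjl hil =>
    simp only [map_add, map_mul, freeToCliff_Ygen, map_zero, sub_mul, mul_sub, cliffE_sq]
    rw [cliffE_anti k n j i hij.symm, cliffE_anti k n l i hil.symm]
    abel
  | disj i j s t hij hst h1 h2 h3 h4 =>
    simp only [map_add, map_mul, freeToCliff_Ygen, map_zero, sub_mul, mul_sub]
    rw [cliffE_anti k n i s h1, cliffE_anti k n i t h2, cliffE_anti k n j s h3,
      cliffE_anti k n j t h4]
    abel

/-- The induced map on the quadratic dual. -/
def dualToCliff (n : ℕ) : FKDual k n →ₐ[k] CliffordAlgebra (sumSqForm k n) :=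
  RingQuot.liftAlgHom k ⟨freeToCliff k n, freeToCliff_rel k n⟩

theorem dualToCliff_yy (n : ℕ) (i j : Fin n) :
    dualToCliff k n (yy k n i j) = cliffE k n i - cliffE k n j := by
  unfold dualToCliff yy
  rw [RingQuot.liftAlgHom_mkAlgHom_apply, freeToCliff_Ygen]

theorem isUnit_diff (n : ℕ) (i j : Fin n) (h : i ≠ j) :
    IsUnit (cliffE k n i - cliffE k n j) := by
  have hsq : (cliffE k n i - cliffE k n j) * (cliffE k n i - cliffE k n j)
      = algebraMap k _ 2 := by
    simp only [sub_mul, mul_sub, cliffE_sq]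
    rw [cliffE_anti k n i j h, map_ofNat, ← one_add_one_eq_two]
    abel
  have h2 : IsUnit (algebraMap k (CliffordAlgebra (sumSqForm k n)) 2) :=
    (IsUnit.mk0 (2 : k) two_ne_zero).map _
  rw [← hsq, ← pow_two] at h2
  exact (isUnit_pow_iff two_ne_zero).mp h2

/-- every monomial in `E_n^!` is nonzero: for any finite
(possibly repeating) list of pairs `(i_s, j_s)` with `i_s < j_s`, the product
`y_{i_1,j_1} y_{i_2,j_2} ⋯ y_{i_w,j_w}` is nonzero in `E_n^!`. -/
theorem FKDual_monomials_ne_zero (n : ℕ) (hn : 2 ≤ n) (L : List (FKIdx n)) :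
    (L.map fun p => yy k n p.1.1 p.1.2).prod ≠ 0 := by
  intro h0
  haveI : Invertible (2 : k) := invertibleOfNonzero two_ne_zero
  have hu : ∀ L : List (FKIdx n),
      IsUnit (dualToCliff k n (L.map fun p => yy k n p.1.1 p.1.2).prod) := by
    intro L
    induction L with
    | nil => simp
    | cons p L ih =>
      rw [List.map_cons, List.prod_cons, map_mul, dualToCliff_yy]
      exact (isUnit_diff k n _ _ (ne_of_lt p.2)).mul ih
  have := hu L
  rw [h0, map_zero] at this
  exact not_isUnit_zero this

end
end

section
/- Let φ: D_n → k be any k-algebra homomorphism and let i, j, l be pairwise distinct indices in {1,…,n}. If φ(a_{i,j}) ≠ 0 and φ(a_{j,l}) ≠ 0, then φ(a_{i,j}) = φ(a_{j,l}) = φ(a_{i,l}); in particular φ(a_{i,l}) ≠ 0. (Thus the values of φ are constant and nonzero on each connected component of the graph on {1,…,n} whose edges are the pairs {i,j} with φ(a_{i,j}) ≠ 0, and each such component is a complete graph.) -/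
/- The commutative algebra `D_n` over an algebraically closed field `k` of
characteristic zero: generated by `a_{i,j}` for `1 ≤ i < j ≤ n` (with the
convention `a_{j,i} = a_{i,j}`), subject to `a_{i,j} a_{j,l} = a_{i,j} a_{i,l}`
for pairwise distinct `i, j, l`; realized as a quotient of a polynomial ring. -/

noncomputable section

variable (k : Type) [Field k] [IsAlgClosed k] [CharZero k]

/-- for any `k`-algebra homomorphism `φ : D_n → k` and pairwise
distinct indices `i, j, l`, if `φ(a_{i,j}) ≠ 0` and `φ(a_{j,l}) ≠ 0` then
`φ(a_{i,j}) = φ(a_{j,l}) = φ(a_{i,l})`; in particular `φ(a_{i,l}) ≠ 0`. -/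
theorem DAlg_point_component (n : ℕ) (hn : 2 ≤ n) (φ : DAlg k n →ₐ[k] k)
    (i j l : Fin n) (hij : i ≠ j) (hjl : j ≠ l) (hil : i ≠ l)
    (h1 : φ (aa k n i j) ≠ 0) (h2 : φ (aa k n j l) ≠ 0) :
    φ (aa k n i j) = φ (aa k n j l) ∧ φ (aa k n j l) = φ (aa k n i l) ∧
      φ (aa k n i l) ≠ 0 := by
  have symm : ∀ a b : Fin n, aa k n a b = aa k n b a := by
    intro a b
    unfold aa Agen
    rcases lt_trichotomy a b with h | h | h
    · simp [h, not_lt_of_gt h]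
    · subst h; rfl
    · simp [h, not_lt_of_gt h]
  have rel : ∀ a b c : Fin n, a ≠ b → b ≠ c → a ≠ c →
      φ (aa k n a b) * φ (aa k n b c) = φ (aa k n a b) * φ (aa k n a c) := by
    intro a b c hab hbc hac
    rw [← map_mul, ← map_mul]
    congr 1
    unfold aa
    rw [← map_mul, ← map_mul, Ideal.Quotient.eq]
    exact Ideal.subset_span ⟨a, b, c, hab, hbc, hac, rfl⟩
  have e1 : φ (aa k n j l) = φ (aa k n i l) :=
    mul_left_cancel₀ h1 (rel i j l hij hjl hil)
  have r2 := rel l j i hjl.symm hij.symm hil.symm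
  rw [symm l j, symm j i, symm l i] at r2
  have e2 : φ (aa k n i j) = φ (aa k n i l) := mul_left_cancel₀ h2 r2
  exact ⟨e2.trans e1.symm, e1, e1 ▸ h2⟩

end
end

section
/- In C', the elements Ω'_1 := x_{23}^2, Ω'_2 := x_{12} x_{23} x_{13} − x_{13} x_{23} x_{12}, and Ω'_3 := x_{13}^2 form a normal sequence: Ω'_1 is central in C'; Ω'_2 is normal in C'/(Ω'_1), with Ω'_2 x_{12} = x_{13} Ω'_2, Ω'_2 x_{13} = x_{12} Ω'_2, and Ω'_2 x_{23} = −x_{23} Ω'_2 holding in C'/(Ω'_1); and Ω'_3 is central in C'/(Ω'_1, Ω'_2). -/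
/- The algebra `C'` generated by `x_{12}, x_{13}, x_{23}` subject to
`x_{12}² + x_{13}² = 0`, `x_{12}x_{23} - x_{23}x_{13} - x_{13}x_{12} = 0`, and
`x_{23}x_{12} - x_{13}x_{23} - x_{12}x_{13} = 0` (generators indexed by `Fin 3`:
`0 ↦ x_{12}`, `1 ↦ x_{13}`, `2 ↦ x_{23}`). -/

noncomputable section

open FreeAlgebra

variable (k : Type) [Field k] [IsAlgClosed k] [CharZero k]

/-- The defining relations of `C'`. -/
inductive CpRel : FreeAlgebra k (Fin 3) → FreeAlgebra k (Fin 3) → Prop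
  | r1 : CpRel (ι k 0 * ι k 0 + ι k 1 * ι k 1) 0
  | r2 : CpRel (ι k 0 * ι k 2 - ι k 2 * ι k 1 - ι k 1 * ι k 0) 0
  | r3 : CpRel (ι k 2 * ι k 0 - ι k 1 * ι k 2 - ι k 0 * ι k 1) 0

/-- The algebra `C'`. -/
abbrev Cp := RingQuot (CpRel k)

/-- The generator `x_{12}` of `C'`. -/
def x12 : Cp k := RingQuot.mkAlgHom k (CpRel k) (ι k 0)
/-- The generator `x_{13}` of `C'`. -/
def x13 : Cp k := RingQuot.mkAlgHom k (CpRel k) (ι k 1)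
/-- The generator `x_{23}` of `C'`. -/
def x23 : Cp k := RingQuot.mkAlgHom k (CpRel k) (ι k 2)

/-- `Ω'₁ = x_{23}²`. -/
def Om1 : Cp k := x23 k ^ 2
/-- `Ω'₂ = x_{12}x_{23}x_{13} - x_{13}x_{23}x_{12}`. -/
def Om2 : Cp k := x12 k * x23 k * x13 k - x13 k * x23 k * x12 k
/-- `Ω'₃ = x_{13}²`. -/
def Om3 : Cp k := x13 k ^ 2

/-- Relation presenting the quotient `C'/(Ω'₁)`. -/
inductive Rel1 : Cp k → Cp k → Prop
  | r : Rel1 (Om1 k) 0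

/-- The quotient `C'/(Ω'₁)`. -/
abbrev Cp1 := RingQuot (Rel1 k)

/-- The quotient map `C' → C'/(Ω'₁)`. -/
def q1 : Cp k →ₐ[k] Cp1 k := RingQuot.mkAlgHom k (Rel1 k)

/-- Relation presenting the quotient `C'/(Ω'₁, Ω'₂)` as a quotient of `C'/(Ω'₁)`. -/
inductive Rel2 : Cp1 k → Cp1 k → Prop
  | r : Rel2 (q1 k (Om2 k)) 0

/-- The quotient `C'/(Ω'₁, Ω'₂)`. -/
abbrev Cp2 := RingQuot (Rel2 k)

/-- The quotient map `C'/(Ω'₁) → C'/(Ω'₁, Ω'₂)`. -/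
def q2 : Cp1 k →ₐ[k] Cp2 k := RingQuot.mkAlgHom k (Rel2 k)

section Helpers

theorem aux_c2a {R : Type*} [Ring R] {a b c : R} (h1 : a * a + b * b = 0)
    (h2 : a * c - c * b - b * a = 0) (h3 : c * a - b * c - a * b = 0) :
    c * c * a = a * (c * c) := by
  linear_combination (norm := noncomm_ring) c * h3 + h3 * b - h2 * c - b * h2 + a * h1 - h1 * a

theorem aux_c2b {R : Type*} [Ring R] {a b c : R} (h1 : a * a + b * b = 0)
    (h2 : a * c - c * b - b * a = 0) (h3 : c * a - b * c - a * b = 0) :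
    c * c * b = b * (c * c) := by
  linear_combination (norm := noncomm_ring) h3 * c - c * h2 + h2 * a - a * h3 + b * h1 - h1 * b

theorem aux_Oa {R : Type*} [Ring R] {a b c : R} (h1 : a * a + b * b = 0)
    (h2 : a * c - c * b - b * a = 0) :
    (a * c * b - b * c * a) * a = b * (a * c * b - b * c * a) := by
  linear_combination (norm := noncomm_ring) a * h1 * b - h1 * a * b + h1 * c * a - a * b * h1
    - b * c * h1 - a * h2 * a - b * h2 * b

theorem aux_Ob {R : Type*} [Ring R] {a b c : R} (h1 : a * a + b * b = 0)
    (h2 : a * c - c * b - b * a = 0) (h3 : c * a - b * c - a * b = 0) :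
    (a * c * b - b * c * a) * b = a * (a * c * b - b * c * a) := by
  linear_combination (norm := noncomm_ring) b * h1 * a - h1 * b * a - c * h1 * b + c * b * h1
    + h2 * a * a - a * h2 * b + h3 * a * b - a * h3 * a

theorem aux_Oc {R : Type*} [Ring R] {a b c : R} (h1 : a * a + b * b = 0)
    (h2 : a * c - c * b - b * a = 0) (h3 : c * a - b * c - a * b = 0) :
    (a * c * b - b * c * a) * c = -(c * (a * c * b - b * c * a)) := by
  linear_combination (norm := noncomm_ring) h1 * a * a - a * a * h1 + h2 * c * a + b * h2 * a
    + a * b * h2 - c * a * h2 + h3 * a * c - h3 * b * a - a * h3 * b - a * c * h3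

theorem aux_neg_right {R : Type*} [Ring R] {w c : R} (h : w * c = -(c * w)) :
    w * c = (-c) * w := by
  rw [h, neg_mul]

theorem aux_neg_left {R : Type*} [Ring R] {w c : R} (h : w * c = -(c * w)) :
    c * w = w * (-c) := by
  rw [mul_neg, h, neg_neg]

theorem aux_b2a {R : Type*} [Ring R] {a b : R} (h1 : a * a + b * b = 0) :
    b * b * a = a * (b * b) := by
  linear_combination (norm := noncomm_ring) h1 * a - a * h1

theorem aux_b2c {R : Type*} [Ring R] {a b c : R} (h1 : a * a + b * b = 0)
    (h2 : a * c - c * b - b * a = 0) (h3 : c * a - b * c - a * b = 0) :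
    b * b * c + (a * c * b - b * c * a) = c * (b * b) := by
  linear_combination (norm := noncomm_ring) h1 * c - c * h1 - a * h2 + h3 * a

theorem aux_ind {K A : Type*} [Field K] [Semiring A] [Algebra K A]
    (f : FreeAlgebra K (Fin 3) →ₐ[K] A) (hf : Function.Surjective f) (P : A → Prop)
    (hs : ∀ r, P (algebraMap K A r)) (hx : ∀ i, P (f (FreeAlgebra.ι K i)))
    (hm : ∀ u v, P u → P v → P (u * v)) (ha : ∀ u v, P u → P v → P (u + v)) (z : A) : P z := by
  obtain ⟨w, rfl⟩ := hf z
  induction w using FreeAlgebra.induction with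
  | grade0 r => simpa using hs r
  | grade1 i => exact hx i
  | mul u v hu hv => simpa using hm _ _ hu hv
  | add u v hu hv => simpa using ha _ _ hu hv

theorem aux_central {K A : Type*} [Field K] [Semiring A] [Algebra K A]
    (f : FreeAlgebra K (Fin 3) →ₐ[K] A) (hf : Function.Surjective f) (w : A)
    (hx : ∀ i, w * f (FreeAlgebra.ι K i) = f (FreeAlgebra.ι K i) * w) (z : A) :
    w * z = z * w := by
  refine aux_ind f hf (fun z => w * z = z * w) (fun r => (Algebra.commutes r w).symm) hx ?_ ?_ z
  · intro u v hu hv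
    rw [← mul_assoc, hu, mul_assoc, hv, mul_assoc]
  · intro u v hu hv
    rw [mul_add, add_mul, hu, hv]

theorem aux_normal_right {K A : Type*} [Field K] [Semiring A] [Algebra K A]
    (f : FreeAlgebra K (Fin 3) →ₐ[K] A) (hf : Function.Surjective f) (w : A)
    (hx : ∀ i, ∃ z', w * f (FreeAlgebra.ι K i) = z' * w) (z : A) :
    ∃ z', w * z = z' * w := by
  refine aux_ind f hf (fun z => ∃ z', w * z = z' * w)
    (fun r => ⟨_, (Algebra.commutes r w).symm⟩) hx ?_ ?_ z
  · rintro u v ⟨u', hu⟩ ⟨v', hv⟩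
    exact ⟨u' * v', by rw [← mul_assoc, hu, mul_assoc, hv, mul_assoc]⟩
  · rintro u v ⟨u', hu⟩ ⟨v', hv⟩
    exact ⟨u' + v', by rw [mul_add, add_mul, hu, hv]⟩

theorem aux_normal_left {K A : Type*} [Field K] [Semiring A] [Algebra K A]
    (f : FreeAlgebra K (Fin 3) →ₐ[K] A) (hf : Function.Surjective f) (w : A)
    (hx : ∀ i, ∃ z', f (FreeAlgebra.ι K i) * w = w * z') (z : A) :
    ∃ z', z * w = w * z' := by
  refine aux_ind f hf (fun z => ∃ z', z * w = w * z')
    (fun r => ⟨_, Algebra.commutes r w⟩) hx ?_ ?_ z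
  · rintro u v ⟨u', hu⟩ ⟨v', hv⟩
    exact ⟨u' * v', by rw [mul_assoc, hv, ← mul_assoc, hu, mul_assoc]⟩
  · rintro u v ⟨u', hu⟩ ⟨v', hv⟩
    exact ⟨u' + v', by rw [mul_add, add_mul, hu, hv]⟩

end Helpers

/-- `{Ω'₁, Ω'₂, Ω'₃}` is a normal sequence in `C'`: `Ω'₁` is
central in `C'`; `Ω'₂` is normal in `C'/(Ω'₁)` with
`Ω'₂ x_{12} = x_{13} Ω'₂`, `Ω'₂ x_{13} = x_{12} Ω'₂`, `Ω'₂ x_{23} = -x_{23} Ω'₂`;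
and `Ω'₃` is central in `C'/(Ω'₁, Ω'₂)`. -/
theorem Cp_normal_sequence :
    (∀ z : Cp k, Om1 k * z = z * Om1 k) ∧
    (q1 k (Om2 k) * q1 k (x12 k) = q1 k (x13 k) * q1 k (Om2 k) ∧
      q1 k (Om2 k) * q1 k (x13 k) = q1 k (x12 k) * q1 k (Om2 k) ∧
      q1 k (Om2 k) * q1 k (x23 k) = -(q1 k (x23 k) * q1 k (Om2 k))) ∧
    ((∀ z : Cp1 k, ∃ z' : Cp1 k, q1 k (Om2 k) * z = z' * q1 k (Om2 k)) ∧
      (∀ z : Cp1 k, ∃ z' : Cp1 k, z * q1 k (Om2 k) = q1 k (Om2 k) * z')) ∧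
    (∀ z : Cp2 k, q2 k (q1 k (Om3 k)) * z = z * q2 k (q1 k (Om3 k))) := by
  have h1 : x12 k * x12 k + x13 k * x13 k = 0 := by
    simpa [x12, x13] using RingQuot.mkAlgHom_rel k (CpRel.r1 (k := k))
  have h2 : x12 k * x23 k - x23 k * x13 k - x13 k * x12 k = 0 := by
    simpa [x12, x13, x23] using RingQuot.mkAlgHom_rel k (CpRel.r2 (k := k))
  have h3 : x23 k * x12 k - x13 k * x23 k - x12 k * x13 k = 0 := by
    simpa [x12, x13, x23] using RingQuot.mkAlgHom_rel k (CpRel.r3 (k := k))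
  have hO2 : q2 k (q1 k (Om2 k)) = 0 := by
    simpa [q2] using RingQuot.mkAlgHom_rel k (Rel2.r (k := k))
  have s0 : Function.Surjective (RingQuot.mkAlgHom k (CpRel k)) :=
    RingQuot.mkAlgHom_surjective k _
  have s1 : Function.Surjective ((q1 k).comp (RingQuot.mkAlgHom k (CpRel k))) :=
    (RingQuot.mkAlgHom_surjective k (Rel1 k)).comp s0
  have s2 : Function.Surjective ((q2 k).comp ((q1 k).comp (RingQuot.mkAlgHom k (CpRel k)))) :=
    (RingQuot.mkAlgHom_surjective k (Rel2 k)).comp s1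
  have ea : q1 k (Om2 k) * q1 k (x12 k) = q1 k (x13 k) * q1 k (Om2 k) := by
    rw [← map_mul, ← map_mul]
    exact congrArg _ (aux_Oa h1 h2)
  have eb : q1 k (Om2 k) * q1 k (x13 k) = q1 k (x12 k) * q1 k (Om2 k) := by
    rw [← map_mul, ← map_mul]
    exact congrArg _ (aux_Ob h1 h2 h3)
  have ec : q1 k (Om2 k) * q1 k (x23 k) = -(q1 k (x23 k) * q1 k (Om2 k)) := by
    rw [← map_mul, ← map_mul]
    exact (congrArg (q1 k) (aux_Oc h1 h2 h3)).trans (map_neg (q1 k) _)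
  refine ⟨?_, ⟨ea, eb, ec⟩, ⟨?_, ?_⟩, ?_⟩
  · refine aux_central _ s0 _ fun i => ?_
    rw [Om1, pow_two]
    fin_cases i
    · exact aux_c2a h1 h2 h3
    · exact aux_c2b h1 h2 h3
    · exact mul_assoc _ _ _
  · refine aux_normal_right _ s1 _ fun i => ?_
    fin_cases i
    · exact ⟨_, ea⟩
    · exact ⟨_, eb⟩
    · refine ⟨q1 k (-x23 k), ?_⟩
      rw [← map_mul]
      exact (map_mul (q1 k) _ _).symm.trans
        (congrArg (q1 k) (aux_neg_right (aux_Oc h1 h2 h3)))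
  · refine aux_normal_left _ s1 _ fun i => ?_
    fin_cases i
    · exact ⟨_, eb.symm⟩
    · exact ⟨_, ea.symm⟩
    · refine ⟨q1 k (-x23 k), ?_⟩
      have e : x23 k * Om2 k = Om2 k * -x23 k :=
        aux_neg_left (aux_Oc h1 h2 h3)
      rw [← map_mul, ← e]
      exact (map_mul (q1 k) _ _).symm
  · have ga : Om3 k * x12 k = x12 k * Om3 k := by
      rw [Om3, pow_two]
      exact aux_b2a h1
    have gc : Om3 k * x23 k + Om2 k = x23 k * Om3 k := by
      rw [Om3, pow_two]
      exact aux_b2c h1 h2 h3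
    have fa := congrArg (fun t => q2 k (q1 k t)) ga
    have fb := congrArg (fun t => q2 k (q1 k t)) ((pow_mul_comm' (x13 k) 2))
    have fc := congrArg (fun t => q2 k (q1 k t)) gc
    simp only [map_mul] at fa fb
    simp only [map_add, map_mul, hO2, add_zero] at fc
    refine aux_central _ s2 _ fun i => ?_
    fin_cases i
    · exact fa
    · exact fb
    · exact fc

end
end

section
/- With Ω'_1 := x_{23}^2, Ω'_2 := x_{12} x_{23} x_{13} − x_{13} x_{23} x_{12}, and Ω'_3 := x_{13}^2, the quotient algebra C'/(Ω'_1, Ω'_2, Ω'_3) is isomorphic as a k-algebra to the Fomin–Kirillov algebra E_3, via the map sending each generator x_{ij} of C' to the corresponding generator x_{ij} of E_3. (Equivalently: in C'/(x_{23}^2, x_{13}^2) the element Ω'_2 already vanishes, and C'/(x_{23}^2, x_{13}^2) ≅ E_3.) -/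
/- The algebra `C'` generated by `x_{12}, x_{13}, x_{23}` subject to
`x_{12}² + x_{13}² = 0`, `x_{12}x_{23} - x_{23}x_{13} - x_{13}x_{12} = 0`, and
`x_{23}x_{12} - x_{13}x_{23} - x_{12}x_{13} = 0` (generators indexed by `Fin 3`:
`0 ↦ x_{12}`, `1 ↦ x_{13}`, `2 ↦ x_{23}`). -/

noncomputable section

open FreeAlgebra

variable (k : Type) [Field k] [IsAlgClosed k] [CharZero k]

/-- The defining relations of the Fomin–Kirillov algebra `E_3` (generators
indexed by `Fin 3`: `0 ↦ x_{12}`, `1 ↦ x_{13}`, `2 ↦ x_{23}`). -/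
inductive E3Rel : FreeAlgebra k (Fin 3) → FreeAlgebra k (Fin 3) → Prop
  | r1 : E3Rel (ι k 0 * ι k 0) 0
  | r2 : E3Rel (ι k 1 * ι k 1) 0
  | r3 : E3Rel (ι k 2 * ι k 2) 0
  | r4 : E3Rel (ι k 0 * ι k 2 - ι k 2 * ι k 1 - ι k 1 * ι k 0) 0
  | r5 : E3Rel (ι k 2 * ι k 0 - ι k 1 * ι k 2 - ι k 0 * ι k 1) 0

/-- The Fomin–Kirillov algebra `E_3`. -/
abbrev E3 := RingQuot (E3Rel k)

/-- Relations presenting the quotient `C'/(Ω'₁, Ω'₂, Ω'₃)`. -/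
inductive OmRel : Cp k → Cp k → Prop
  | r1 : OmRel (Om1 k) 0
  | r2 : OmRel (Om2 k) 0
  | r3 : OmRel (Om3 k) 0

/-- The quotient `C'/(Ω'₁, Ω'₂, Ω'₃)`. -/
abbrev CpQ := RingQuot (OmRel k)

/-- `C'/(Ω'₁, Ω'₂, Ω'₃)` is isomorphic as a `k`-algebra to the
Fomin–Kirillov algebra `E_3`, via the map sending (the image of) each
generator `x_{ij}` of `C'` to the corresponding generator `x_{ij}` of `E_3`. -/
theorem CpQ_iso_E3 :
    ∃ f : CpQ k ≃ₐ[k] E3 k,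
      ∀ i : Fin 3,
        f (RingQuot.mkAlgHom k (OmRel k) (RingQuot.mkAlgHom k (CpRel k) (ι k i))) =
          RingQuot.mkAlgHom k (E3Rel k) (ι k i) := by
  -- relations in `E_3`
  have e1 := RingQuot.mkAlgHom_rel k (E3Rel.r1 (k := k))
  have e2 := RingQuot.mkAlgHom_rel k (E3Rel.r2 (k := k))
  have e3 := RingQuot.mkAlgHom_rel k (E3Rel.r3 (k := k))
  have e4 := RingQuot.mkAlgHom_rel k (E3Rel.r4 (k := k))
  have e5 := RingQuot.mkAlgHom_rel k (E3Rel.r5 (k := k))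
  simp only [map_mul, map_sub, map_zero] at e1 e2 e3 e4 e5
  -- relations in the quotient of `C'`
  have c1 := congrArg (RingQuot.mkAlgHom k (OmRel k))
    (RingQuot.mkAlgHom_rel k (CpRel.r1 (k := k)))
  have c2 := congrArg (RingQuot.mkAlgHom k (OmRel k))
    (RingQuot.mkAlgHom_rel k (CpRel.r2 (k := k)))
  have c3 := congrArg (RingQuot.mkAlgHom k (OmRel k))
    (RingQuot.mkAlgHom_rel k (CpRel.r3 (k := k)))
  have o1 := RingQuot.mkAlgHom_rel k (OmRel.r1 (k := k))
  have o3 := RingQuot.mkAlgHom_rel k (OmRel.r3 (k := k))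
  simp only [Om1, Om3, x23, x13, pow_two, map_mul, map_sub, map_add, map_zero]
    at c1 c2 c3 o1 o3
  -- `Ω'₂` vanishes as a consequence of the other relations
  have key : ∀ {R : Type} [Ring R] {a b c : R}, b * b = 0 → a * c - c * b - b * a = 0 →
      c * a - b * c - a * b = 0 → a * c * b - b * c * a = 0 := by
    intro R _ a b c h2 h4 h5
    calc a * c * b - b * c * a
        = (a * c - c * b - b * a) * b - b * (c * a - b * c - a * b)
            + c * (b * b) - (b * b) * c := by noncomm_ring
      _ = 0 := by rw [h4, h5, h2]; simp
  -- the map from `C'` to `E_3`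
  let g : Cp k →ₐ[k] E3 k := RingQuot.liftAlgHom k ⟨RingQuot.mkAlgHom k (E3Rel k), by
    intro x y h
    cases h with
    | r1 => simp only [map_mul, map_add, map_zero, e1, e2, add_zero]
    | r2 => simpa only [map_mul, map_sub, map_zero] using e4
    | r3 => simpa only [map_mul, map_sub, map_zero] using e5⟩
  have hg : ∀ x, g (RingQuot.mkAlgHom k (CpRel k) x) = RingQuot.mkAlgHom k (E3Rel k) x :=
    fun x => RingQuot.liftAlgHom_mkAlgHom_apply ..
  let F : CpQ k →ₐ[k] E3 k := RingQuot.liftAlgHom k ⟨g, by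
    intro x y h
    cases h with
    | r1 => simp only [Om1, x23, pow_two, map_mul, map_zero, hg, e3]
    | r2 =>
      simp only [Om2, x12, x13, x23, map_mul, map_sub, map_zero, hg]
      exact key e2 e4 e5
    | r3 => simp only [Om3, x13, pow_two, map_mul, map_zero, hg, e2]⟩
  have hF : ∀ x, F (RingQuot.mkAlgHom k (OmRel k) x) = g x :=
    fun x => RingQuot.liftAlgHom_mkAlgHom_apply ..
  -- the inverse map
  let G : E3 k →ₐ[k] CpQ k := RingQuot.liftAlgHom k
    ⟨(RingQuot.mkAlgHom k (OmRel k)).comp (RingQuot.mkAlgHom k (CpRel k)), by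
    intro x y h
    cases h with
    | r1 =>
      simp only [AlgHom.comp_apply, map_mul, map_zero]
      rwa [o3, add_zero] at c1
    | r2 => simpa only [AlgHom.comp_apply, map_mul, map_zero] using o3
    | r3 => simpa only [AlgHom.comp_apply, map_mul, map_zero] using o1
    | r4 => simpa only [AlgHom.comp_apply, map_mul, map_sub, map_zero] using c2
    | r5 => simpa only [AlgHom.comp_apply, map_mul, map_sub, map_zero] using c3⟩
  have hG : ∀ x, G (RingQuot.mkAlgHom k (E3Rel k) x) =
      RingQuot.mkAlgHom k (OmRel k) (RingQuot.mkAlgHom k (CpRel k) x) :=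
    fun x => RingQuot.liftAlgHom_mkAlgHom_apply ..
  refine ⟨AlgEquiv.ofAlgHom F G ?_ ?_, ?_⟩
  · apply AlgHom.ext
    intro y
    obtain ⟨x, rfl⟩ := RingQuot.mkAlgHom_surjective k (E3Rel k) y
    simp only [AlgHom.comp_apply, hG, hF, hg, AlgHom.id_apply]
  · apply AlgHom.ext
    intro y
    obtain ⟨z, rfl⟩ := RingQuot.mkAlgHom_surjective k (OmRel k) y
    obtain ⟨x, rfl⟩ := RingQuot.mkAlgHom_surjective k (CpRel k) z
    simp only [AlgHom.comp_apply, hG, hF, hg, AlgHom.id_apply]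
  · intro i
    simp only [AlgEquiv.ofAlgHom_apply, hF, hg]

end
end

section
/- Let Ω''_1 := (ab + ba)c, Ω''_2 := −2bc + a^2 − b^2, and Ω''_3 := −2ac + (ab − ba) in C''. Then: (1) {Ω''_1, Ω''_2, Ω''_3} is a normal sequence in C'', i.e., Ω''_1 is normal in C'' (with Ω''_1 c = −c Ω''_1), Ω''_2 is normal in C''/(Ω''_1) (indeed central there), and Ω''_3 is normal in C''/(Ω''_1, Ω''_2); and (2) the quotient C''/(Ω''_1, Ω''_2, Ω''_3) is isomorphic as a k-algebra to E_3^!, via a ↦ y_{13}+y_{23}, b ↦ y_{13}−y_{23}, c ↦ y_{12}. -/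
/- The algebra `C''` generated by `a, b, c` subject to `ca + ac = 0`,
`cb - bc = 0`, `a²b - ba² = 0`, `ab² - b²a = 0` (generators indexed by
`Fin 3`: `0 ↦ a`, `1 ↦ b`, `2 ↦ c`), and the algebra `E_3^!` generated by
`y_{12}, y_{13}, y_{23}` (indexed `0 ↦ y_{12}`, `1 ↦ y_{13}`, `2 ↦ y_{23}`)
subject to `y_{12}y_{23} + y_{23}y_{13} = 0`, `y_{12}y_{23} + y_{13}y_{12} = 0`,
`y_{23}y_{12} + y_{13}y_{23} = 0`, `y_{23}y_{12} + y_{12}y_{13} = 0`. -/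

noncomputable section

open FreeAlgebra

variable (k : Type) [Field k] [IsAlgClosed k] [CharZero k]

/-- The defining relations of `C''`. -/
inductive CppRel : FreeAlgebra k (Fin 3) → FreeAlgebra k (Fin 3) → Prop
  | r1 : CppRel (ι k 2 * ι k 0 + ι k 0 * ι k 2) 0
  | r2 : CppRel (ι k 2 * ι k 1 - ι k 1 * ι k 2) 0
  | r3 : CppRel (ι k 0 * ι k 0 * ι k 1 - ι k 1 * (ι k 0 * ι k 0)) 0
  | r4 : CppRel (ι k 0 * (ι k 1 * ι k 1) - ι k 1 * ι k 1 * ι k 0) 0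

/-- The algebra `C''`. -/
abbrev Cpp := RingQuot (CppRel k)

/-- The generator `a` of `C''`. -/
def ga : Cpp k := RingQuot.mkAlgHom k (CppRel k) (ι k 0)
/-- The generator `b` of `C''`. -/
def gb : Cpp k := RingQuot.mkAlgHom k (CppRel k) (ι k 1)
/-- The generator `c` of `C''`. -/
def gc : Cpp k := RingQuot.mkAlgHom k (CppRel k) (ι k 2)

/-- `Ω''₁ = (ab + ba)c`. -/
def W1 : Cpp k := (ga k * gb k + gb k * ga k) * gc k
/-- `Ω''₂ = -2bc + a² - b²`. -/
def W2 : Cpp k := -(2 : Cpp k) * (gb k * gc k) + ga k ^ 2 - gb k ^ 2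
/-- `Ω''₃ = -2ac + (ab - ba)`. -/
def W3 : Cpp k := -(2 : Cpp k) * (ga k * gc k) + (ga k * gb k - gb k * ga k)

/-- Relation presenting the quotient `C''/(Ω''₁)`. -/
inductive WRel1 : Cpp k → Cpp k → Prop
  | r : WRel1 (W1 k) 0

/-- The quotient `C''/(Ω''₁)`. -/
abbrev Cpp1 := RingQuot (WRel1 k)

/-- The quotient map `C'' → C''/(Ω''₁)`. -/
def p1 : Cpp k →ₐ[k] Cpp1 k := RingQuot.mkAlgHom k (WRel1 k)

/-- Relation presenting the quotient `C''/(Ω''₁, Ω''₂)` as a quotient of `C''/(Ω''₁)`. -/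
inductive WRel2 : Cpp1 k → Cpp1 k → Prop
  | r : WRel2 (p1 k (W2 k)) 0

/-- The quotient `C''/(Ω''₁, Ω''₂)`. -/
abbrev Cpp2 := RingQuot (WRel2 k)

/-- The quotient map `C''/(Ω''₁) → C''/(Ω''₁, Ω''₂)`. -/
def p2 : Cpp1 k →ₐ[k] Cpp2 k := RingQuot.mkAlgHom k (WRel2 k)

/-- Relations presenting the quotient `C''/(Ω''₁, Ω''₂, Ω''₃)`. -/
inductive WRel : Cpp k → Cpp k → Prop
  | r1 : WRel (W1 k) 0
  | r2 : WRel (W2 k) 0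
  | r3 : WRel (W3 k) 0

/-- The quotient `C''/(Ω''₁, Ω''₂, Ω''₃)`. -/
abbrev CppQ := RingQuot (WRel k)

/-- The defining relations of `E_3^!`. -/
inductive E3dRel : FreeAlgebra k (Fin 3) → FreeAlgebra k (Fin 3) → Prop
  | r1 : E3dRel (ι k 0 * ι k 2 + ι k 2 * ι k 1) 0
  | r2 : E3dRel (ι k 0 * ι k 2 + ι k 1 * ι k 0) 0
  | r3 : E3dRel (ι k 2 * ι k 0 + ι k 1 * ι k 2) 0
  | r4 : E3dRel (ι k 2 * ι k 0 + ι k 0 * ι k 1) 0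

/-- The algebra `E_3^!`. -/
abbrev E3d := RingQuot (E3dRel k)

set_option linter.unusedSectionVars false

lemma quot_zero {k A : Type} [Field k] [Ring A] [Algebra k A] {r : A → A → Prop} {x : A}
    (h : r x 0) : RingQuot.mkAlgHom k r x = 0 := by
  rw [RingQuot.mkAlgHom_rel k h, map_zero]

/-- Left version of normality can be checked on generators. -/
lemma normal_left {k A : Type} [Field k] [Ring A] [Algebra k A]
    (φ : FreeAlgebra k (Fin 3) →ₐ[k] A) (hφ : Function.Surjective φ) (w : A)
    (h : ∀ i, ∃ z', w * φ (ι k i) = z' * w) (z : A) : ∃ z', w * z = z' * w := by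
  obtain ⟨t, rfl⟩ := hφ z
  induction t using FreeAlgebra.induction with
  | grade0 r => exact ⟨algebraMap k A r, by rw [AlgHom.commutes, Algebra.commutes]⟩
  | grade1 i => exact h i
  | mul s t hs ht =>
    obtain ⟨s', hs⟩ := hs
    obtain ⟨t', ht⟩ := ht
    exact ⟨s' * t', by rw [map_mul, ← mul_assoc, hs, mul_assoc, ht, mul_assoc]⟩
  | add s t hs ht =>
    obtain ⟨s', hs⟩ := hs
    obtain ⟨t', ht⟩ := ht
    exact ⟨s' + t', by rw [map_add, mul_add, hs, ht, add_mul]⟩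

/-- Right version of normality can be checked on generators. -/
lemma normal_right {k A : Type} [Field k] [Ring A] [Algebra k A]
    (φ : FreeAlgebra k (Fin 3) →ₐ[k] A) (hφ : Function.Surjective φ) (w : A)
    (h : ∀ i, ∃ z', φ (ι k i) * w = w * z') (z : A) : ∃ z', z * w = w * z' := by
  obtain ⟨t, rfl⟩ := hφ z
  induction t using FreeAlgebra.induction with
  | grade0 r => exact ⟨algebraMap k A r, by rw [AlgHom.commutes, Algebra.commutes]⟩
  | grade1 i => exact h i
  | mul s t hs ht =>
    obtain ⟨s', hs⟩ := hs
    obtain ⟨t', ht⟩ := ht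
    exact ⟨s' * t', by rw [map_mul, mul_assoc, ht, ← mul_assoc, hs, mul_assoc]⟩
  | add s t hs ht =>
    obtain ⟨s', hs⟩ := hs
    obtain ⟨t', ht⟩ := ht
    exact ⟨s' + t', by rw [map_add, add_mul, hs, ht, mul_add]⟩

/-- Centrality can be checked on generators. -/
lemma central_gen {k A : Type} [Field k] [Ring A] [Algebra k A]
    (φ : FreeAlgebra k (Fin 3) →ₐ[k] A) (hφ : Function.Surjective φ) (w : A)
    (h : ∀ i, w * φ (ι k i) = φ (ι k i) * w) (z : A) : w * z = z * w := by
  obtain ⟨t, rfl⟩ := hφ z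
  induction t using FreeAlgebra.induction with
  | grade0 r => rw [AlgHom.commutes, Algebra.commutes]
  | grade1 i => exact h i
  | mul s t hs ht => rw [map_mul, ← mul_assoc, hs, mul_assoc, ht, mul_assoc]
  | add s t hs ht => rw [map_add, mul_add, hs, ht, add_mul]

/-- Two times / four times cancellation. -/
lemma cancel_two {k A : Type} [Field k] [CharZero k] [Ring A] [Algebra k A] {x : A}
    (h : x + x = 0) : x = 0 := by
  have h2 : (2 : k) • x = 0 := by rw [two_smul, h]
  rw [← inv_smul_smul₀ (two_ne_zero (α := k)) x, h2, smul_zero]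

section rels
variable {A : Type} [Ring A] {a b c : A}

lemma w1_a (h1 : c * a + a * c = 0) (h3 : a * a * b - b * (a * a) = 0) :
    (a * b + b * a) * c * a = -(a * ((a * b + b * a) * c)) := by
  linear_combination (norm := noncomm_ring) (a * b + b * a) * h1 + h3 * c

lemma w1_b (h2 : c * b - b * c = 0) (h4 : a * (b * b) - b * b * a = 0) :
    (a * b + b * a) * c * b = b * ((a * b + b * a) * c) := by
  linear_combination (norm := noncomm_ring) (a * b + b * a) * h2 + h4 * c

lemma w1_c (h1 : c * a + a * c = 0) (h2 : c * b - b * c = 0) :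
    (a * b + b * a) * c * c = -(c * ((a * b + b * a) * c)) := by
  linear_combination (norm := noncomm_ring)
    h1 * b * c - a * h2 * c + h2 * a * c + b * h1 * c

lemma w2_a (h1 : c * a + a * c = 0)
    (h4 : a * (b * b) - b * b * a = 0) (hw : (a * b + b * a) * c = 0) :
    (-(2 : A) * (b * c) + a ^ 2 - b ^ 2) * a = a * (-(2 : A) * (b * c) + a ^ 2 - b ^ 2) := by
  linear_combination (norm := noncomm_ring) (-2 : A) * b * h1 + 2 * hw + h4

lemma w2_b (h2 : c * b - b * c = 0) (h3 : a * a * b - b * (a * a) = 0) :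
    (-(2 : A) * (b * c) + a ^ 2 - b ^ 2) * b = b * (-(2 : A) * (b * c) + a ^ 2 - b ^ 2) := by
  linear_combination (norm := noncomm_ring) (-2 : A) * b * h2 + h3

lemma w2_c (h1 : c * a + a * c = 0) (h2 : c * b - b * c = 0) :
    (-(2 : A) * (b * c) + a ^ 2 - b ^ 2) * c = c * (-(2 : A) * (b * c) + a ^ 2 - b ^ 2) := by
  linear_combination (norm := noncomm_ring)
    (2 : A) * h2 * c + a * h1 - h1 * a + h2 * b + b * h2

lemma w3_a (h1 : c * a + a * c = 0) (h3 : a * a * b - b * (a * a) = 0) :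
    (-(2 : A) * (a * c) + (a * b - b * a)) * a =
      -(a * (-(2 : A) * (a * c) + (a * b - b * a))) := by
  linear_combination (norm := noncomm_ring) (-2 : A) * a * h1 + h3

lemma w3_b (h2 : c * b - b * c = 0) (h4 : a * (b * b) - b * b * a = 0)
    (hw : (a * b + b * a) * c = 0) :
    (-(2 : A) * (a * c) + (a * b - b * a)) * b =
      -(b * (-(2 : A) * (a * c) + (a * b - b * a))) := by
  linear_combination (norm := noncomm_ring) (-2 : A) * a * h2 + h4 - 2 * hw

lemma w3_c (h1 : c * a + a * c = 0) (h2 : c * b - b * c = 0) :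
    (-(2 : A) * (a * c) + (a * b - b * a)) * c =
      -(c * (-(2 : A) * (a * c) + (a * b - b * a))) := by
  linear_combination (norm := noncomm_ring)
    (-2 : A) * h1 * c + h1 * b - a * h2 - h2 * a - b * h1

end rels

lemma cpp_h1 : gc k * ga k + ga k * gc k = 0 := by
  simpa only [map_add, map_mul, ga, gb, gc] using quot_zero (k := k) (CppRel.r1 (k := k))
lemma cpp_h2 : gc k * gb k - gb k * gc k = 0 := by
  simpa only [map_sub, map_mul, ga, gb, gc] using quot_zero (k := k) (CppRel.r2 (k := k))
lemma cpp_h3 : ga k * ga k * gb k - gb k * (ga k * ga k) = 0 := by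
  simpa only [map_sub, map_mul, ga, gb, gc] using quot_zero (k := k) (CppRel.r3 (k := k))
lemma cpp_h4 : ga k * (gb k * gb k) - gb k * gb k * ga k = 0 := by
  simpa only [map_sub, map_mul, ga, gb, gc] using quot_zero (k := k) (CppRel.r4 (k := k))

section maps
variable {B : Type} [Ring B] [Algebra k B] (φ : Cpp k →ₐ[k] B)
lemma map_h1 : φ (gc k) * φ (ga k) + φ (ga k) * φ (gc k) = 0 := by
  simpa only [map_add, map_mul, map_zero] using congrArg φ (cpp_h1 k)
lemma map_h2 : φ (gc k) * φ (gb k) - φ (gb k) * φ (gc k) = 0 := by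
  simpa only [map_sub, map_mul, map_zero] using congrArg φ (cpp_h2 k)
lemma map_h3 : φ (ga k) * φ (ga k) * φ (gb k) - φ (gb k) * (φ (ga k) * φ (ga k)) = 0 := by
  simpa only [map_sub, map_mul, map_zero] using congrArg φ (cpp_h3 k)
lemma map_h4 : φ (ga k) * (φ (gb k) * φ (gb k)) - φ (gb k) * φ (gb k) * φ (ga k) = 0 := by
  simpa only [map_sub, map_mul, map_zero] using congrArg φ (cpp_h4 k)
lemma map_W1 : φ (W1 k) = (φ (ga k) * φ (gb k) + φ (gb k) * φ (ga k)) * φ (gc k) := by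
  simp only [W1, map_add, map_mul]
lemma map_W2 : φ (W2 k) =
    -(2 : B) * (φ (gb k) * φ (gc k)) + φ (ga k) ^ 2 - φ (gb k) ^ 2 := by
  simp only [W2, map_add, map_sub, map_mul, map_neg, map_pow, map_ofNat]
lemma map_W3 : φ (W3 k) = -(2 : B) * (φ (ga k) * φ (gc k)) +
    (φ (ga k) * φ (gb k) - φ (gb k) * φ (ga k)) := by
  simp only [W3, map_add, map_sub, map_mul, map_neg, map_ofNat]
end maps

section E3
variable {A : Type} [Ring A] {x y z : A}
lemma e_r3 (h1 : x * z + z * y = 0) (h2 : x * z + y * x = 0) (h3 : z * x + y * z = 0)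
    (h4 : z * x + x * y = 0) :
    (y + z) * (y + z) * (y - z) - (y - z) * ((y + z) * (y + z)) = 0 := by
  -- `ab - ba = 2ac` and `ca + ac = 0`
  have e : (y + z) * (y - z) - (y - z) * (y + z) = 2 * ((y + z) * x) := by
    linear_combination (norm := noncomm_ring) 2 * h1 - 2 * h2 - 2 * h3
  have e' : x * (y + z) + (y + z) * x = 0 := by
    linear_combination (norm := noncomm_ring) h2 + h4
  linear_combination (norm := noncomm_ring) (y + z) * e + e * (y + z) + 2 * (y + z) * e'

lemma e_w1 (h1 : x * z + z * y = 0) (h2 : x * z + y * x = 0) (h3 : z * x + y * z = 0)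
    (h4 : z * x + x * y = 0) :
    ((y + z) * (y - z) + (y - z) * (y + z)) * x = 0 := by
  have e : y * y * x = z * z * x := by
    linear_combination (norm := noncomm_ring) y * h2 - y * h1 + h3 * y - z * h4
  linear_combination (norm := noncomm_ring) 2 * e

lemma e_r4 (h1 : x * z + z * y = 0) (h2 : x * z + y * x = 0) (h3 : z * x + y * z = 0)
    (h4 : z * x + x * y = 0) :
    (y + z) * ((y - z) * (y - z)) - (y - z) * (y - z) * (y + z) = 0 := by
  have e : (y + z) * (y - z) - (y - z) * (y + z) = 2 * ((y + z) * x) := by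
    linear_combination (norm := noncomm_ring) 2 * h1 - 2 * h2 - 2 * h3
  have e' : x * (y - z) - (y - z) * x = 0 := by
    linear_combination (norm := noncomm_ring) h4 - h2
  have w := e_w1 h1 h2 h3 h4
  linear_combination (norm := noncomm_ring)
    (y - z) * e + e * (y - z) + 2 * (y + z) * e' + 2 * w
end E3

lemma f_all (k : Type) [Field k] [CharZero k] {A : Type} [Ring A] [Algebra k A] {x y z : A}
    (h1 : x * (y + z) + (y + z) * x = 0) (h2 : x * (y - z) - (y - z) * x = 0)
    (w2 : -(2 : A) * ((y - z) * x) + (y + z) ^ 2 - (y - z) ^ 2 = 0)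
    (w3 : -(2 : A) * ((y + z) * x) + ((y + z) * (y - z) - (y - z) * (y + z)) = 0) :
    x * z + z * y = 0 ∧ x * z + y * x = 0 ∧ z * x + y * z = 0 ∧ z * x + x * y = 0 := by
  have e2 : x * z + y * x = 0 := by
    apply cancel_two (k := k)
    linear_combination (norm := noncomm_ring) h1 - h2
  have e4 : z * x + x * y = 0 := by
    apply cancel_two (k := k)
    linear_combination (norm := noncomm_ring) h1 + h2
  have e1 : x * z + z * y = 0 := by
    apply cancel_two (k := k)
    apply cancel_two (k := k)
    linear_combination (norm := noncomm_ring) w2 + w3 + 4 * e2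
  have e3 : z * x + y * z = 0 := by
    apply cancel_two (k := k)
    apply cancel_two (k := k)
    linear_combination (norm := noncomm_ring) w2 - w3
  exact ⟨e1, e2, e3, e4⟩

section E3b
variable {A : Type} [Ring A] {x y z : A}
lemma e_r2 (h2 : x * z + y * x = 0) (h4 : z * x + x * y = 0) :
    x * (y - z) - (y - z) * x = 0 := by
  linear_combination (norm := noncomm_ring) h4 - h2
lemma e_w2 (h1 : x * z + z * y = 0) (h2 : x * z + y * x = 0) (h3 : z * x + y * z = 0) :
    -(2 : A) * ((y - z) * x) + (y + z) ^ 2 - (y - z) ^ 2 = 0 := by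
  linear_combination (norm := noncomm_ring) 2 * h1 - 2 * h2 + 2 * h3
lemma e_w3 (h1 : x * z + z * y = 0) (h2 : x * z + y * x = 0) (h3 : z * x + y * z = 0) :
    -(2 : A) * ((y + z) * x) + ((y + z) * (y - z) - (y - z) * (y + z)) = 0 := by
  linear_combination (norm := noncomm_ring) 2 * h1 - 2 * h2 - 2 * h3
end E3b

lemma e3_all :
    let x : E3d k := RingQuot.mkAlgHom k (E3dRel k) (ι k 0)
    let y : E3d k := RingQuot.mkAlgHom k (E3dRel k) (ι k 1)
    let z : E3d k := RingQuot.mkAlgHom k (E3dRel k) (ι k 2)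
    x * z + z * y = 0 ∧ x * z + y * x = 0 ∧ z * x + y * z = 0 ∧ z * x + x * y = 0 := by
  refine ⟨?_, ?_, ?_, ?_⟩
  · simpa only [map_add, map_mul] using quot_zero (k := k) (E3dRel.r1 (k := k))
  · simpa only [map_add, map_mul] using quot_zero (k := k) (E3dRel.r2 (k := k))
  · simpa only [map_add, map_mul] using quot_zero (k := k) (E3dRel.r3 (k := k))
  · simpa only [map_add, map_mul] using quot_zero (k := k) (E3dRel.r4 (k := k))

/-- The map `C'' → E_3^!`. -/
lemma exists_F0 : ∃ f : Cpp k →ₐ[k] E3d k,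
    f (ga k) = RingQuot.mkAlgHom k (E3dRel k) (ι k 1) + RingQuot.mkAlgHom k (E3dRel k) (ι k 2) ∧
    f (gb k) = RingQuot.mkAlgHom k (E3dRel k) (ι k 1) - RingQuot.mkAlgHom k (E3dRel k) (ι k 2) ∧
    f (gc k) = RingQuot.mkAlgHom k (E3dRel k) (ι k 0) := by
  obtain ⟨h1, h2, h3, h4⟩ := e3_all k
  set x : E3d k := RingQuot.mkAlgHom k (E3dRel k) (ι k 0)
  set y : E3d k := RingQuot.mkAlgHom k (E3dRel k) (ι k 1)
  set z : E3d k := RingQuot.mkAlgHom k (E3dRel k) (ι k 2)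
  let g : FreeAlgebra k (Fin 3) →ₐ[k] E3d k := FreeAlgebra.lift k ![y + z, y - z, x]
  have g0 : g (ι k 0) = y + z := by simp [g]
  have g1 : g (ι k 1) = y - z := by simp [g]
  have g2 : g (ι k 2) = x := by simp [g]
  have hg : ∀ ⦃u v⦄, CppRel k u v → g u = g v := by
    intro u v huv
    cases huv with
    | r1 =>
      simp only [map_add, map_mul, map_zero, g0, g2]
      linear_combination (norm := noncomm_ring) h2 + h4
    | r2 =>
      simp only [map_sub, map_mul, map_zero, g1, g2]
      exact e_r2 h2 h4
    | r3 =>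
      simp only [map_sub, map_mul, map_zero, g0, g1]
      exact e_r3 h1 h2 h3 h4
    | r4 =>
      simp only [map_sub, map_mul, map_zero, g0, g1]
      exact e_r4 h1 h2 h3 h4
  refine ⟨RingQuot.liftAlgHom k ⟨g, hg⟩, ?_, ?_, ?_⟩
  · rw [ga, RingQuot.liftAlgHom_mkAlgHom_apply, g0]
  · rw [gb, RingQuot.liftAlgHom_mkAlgHom_apply, g1]
  · rw [gc, RingQuot.liftAlgHom_mkAlgHom_apply, g2]

/-- The map `C''/(Ω) → E_3^!`. -/
lemma exists_F : ∃ f : CppQ k →ₐ[k] E3d k,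
    f (RingQuot.mkAlgHom k (WRel k) (ga k)) =
      RingQuot.mkAlgHom k (E3dRel k) (ι k 1) + RingQuot.mkAlgHom k (E3dRel k) (ι k 2) ∧
    f (RingQuot.mkAlgHom k (WRel k) (gb k)) =
      RingQuot.mkAlgHom k (E3dRel k) (ι k 1) - RingQuot.mkAlgHom k (E3dRel k) (ι k 2) ∧
    f (RingQuot.mkAlgHom k (WRel k) (gc k)) = RingQuot.mkAlgHom k (E3dRel k) (ι k 0) := by
  obtain ⟨f, fa, fb, fc⟩ := exists_F0 k
  obtain ⟨h1, h2, h3, h4⟩ := e3_all k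
  have hf : ∀ ⦃u v⦄, WRel k u v → f u = f v := by
    intro u v huv
    cases huv with
    | r1 => rw [map_W1, map_zero, fa, fb, fc]; exact e_w1 h1 h2 h3 h4
    | r2 =>
      rw [map_W2, map_zero, fa, fb, fc]
      exact e_w2 h1 h2 h3
    | r3 =>
      rw [map_W3, map_zero, fa, fb, fc]
      exact e_w3 h1 h2 h3
  refine ⟨RingQuot.liftAlgHom k ⟨f, hf⟩, ?_, ?_, ?_⟩
  · rw [RingQuot.liftAlgHom_mkAlgHom_apply, fa]
  · rw [RingQuot.liftAlgHom_mkAlgHom_apply, fb]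
  · rw [RingQuot.liftAlgHom_mkAlgHom_apply, fc]

/-- The inverse map `E_3^! → C''/(Ω)`. -/
lemma exists_G : ∃ g : E3d k →ₐ[k] CppQ k,
    g (RingQuot.mkAlgHom k (E3dRel k) (ι k 0)) = RingQuot.mkAlgHom k (WRel k) (gc k) ∧
    g (RingQuot.mkAlgHom k (E3dRel k) (ι k 1)) = (2⁻¹ : k) •
      (RingQuot.mkAlgHom k (WRel k) (ga k) + RingQuot.mkAlgHom k (WRel k) (gb k)) ∧
    g (RingQuot.mkAlgHom k (E3dRel k) (ι k 2)) = (2⁻¹ : k) •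
      (RingQuot.mkAlgHom k (WRel k) (ga k) - RingQuot.mkAlgHom k (WRel k) (gb k)) := by
  have m1 := map_h1 k (B := CppQ k) (RingQuot.mkAlgHom k (WRel k))
  have m2 := map_h2 k (B := CppQ k) (RingQuot.mkAlgHom k (WRel k))
  have w2 := quot_zero (k := k) (WRel.r2 (k := k))
  have w3 := quot_zero (k := k) (WRel.r3 (k := k))
  rw [map_W2 k (B := CppQ k)] at w2
  rw [map_W3 k (B := CppQ k)] at w3
  generalize RingQuot.mkAlgHom k (WRel k) (ga k) = a at *
  generalize RingQuot.mkAlgHom k (WRel k) (gb k) = b at *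
  generalize RingQuot.mkAlgHom k (WRel k) (gc k) = x at *
  obtain ⟨y, hy⟩ : ∃ y, y = (2⁻¹ : k) • (a + b) := ⟨_, rfl⟩
  obtain ⟨z, hz⟩ : ∃ z, z = (2⁻¹ : k) • (a - b) := ⟨_, rfl⟩
  have ha : a = y + z := by rw [hy, hz]; module
  have hb : b = y - z := by rw [hy, hz]; module
  rw [← hy, ← hz]
  rw [ha, hb] at w2 w3
  rw [ha] at m1
  rw [hb] at m2
  obtain ⟨e1, e2, e3, e4⟩ := f_all k m1 m2 w2 w3
  let g : FreeAlgebra k (Fin 3) →ₐ[k] CppQ k := FreeAlgebra.lift k ![x, y, z]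
  have g0 : g (ι k 0) = x := by simp [g]
  have g1 : g (ι k 1) = y := by simp [g]
  have g2 : g (ι k 2) = z := by simp [g]
  have hg : ∀ ⦃u v⦄, E3dRel k u v → g u = g v := by
    intro u v huv
    cases huv <;> simp only [map_add, map_mul, map_zero, g0, g1, g2] <;> assumption
  refine ⟨RingQuot.liftAlgHom k ⟨g, hg⟩, ?_, ?_, ?_⟩
  · rw [RingQuot.liftAlgHom_mkAlgHom_apply, g0]
  · rw [RingQuot.liftAlgHom_mkAlgHom_apply, g1]
  · rw [RingQuot.liftAlgHom_mkAlgHom_apply, g2]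


lemma alg_half_sub {k A B : Type} [Field k] [CharZero k] [Ring A] [Ring B] [Algebra k A]
    [Algebra k B] (f : A →ₐ[k] B) {a b : A} {y z : B} (ha : f a = y + z) (hb : f b = y - z) :
    f ((2⁻¹ : k) • (a - b)) = z := by
  rw [map_smul, map_sub, ha, hb]
  module

lemma anti_left {A : Type} [Ring A] {w g : A} (h : w * g = -(g * w)) :
    ∃ z', w * g = z' * w := ⟨-g, by rw [h, neg_mul]⟩

lemma anti_right {A : Type} [Ring A] {w g : A} (h : w * g = -(g * w)) :
    ∃ z', g * w = w * z' := ⟨-g, by rw [mul_neg, h, neg_neg]⟩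

/-- `{Ω''₁, Ω''₂, Ω''₃}` is a normal sequence in `C''` (with
`Ω''₁ c = -c Ω''₁`, `Ω''₂` central in `C''/(Ω''₁)`, and `Ω''₃` normal in
`C''/(Ω''₁, Ω''₂)`), and `C''/(Ω''₁, Ω''₂, Ω''₃)` is isomorphic as a
`k`-algebra to `E_3^!` via `a ↦ y_{13}+y_{23}`, `b ↦ y_{13}−y_{23}`,
`c ↦ y_{12}`. -/
theorem Cpp_normal_sequence_and_iso_E3d :
    ((∀ z : Cpp k, ∃ z' : Cpp k, W1 k * z = z' * W1 k) ∧
      (∀ z : Cpp k, ∃ z' : Cpp k, z * W1 k = W1 k * z') ∧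
      W1 k * gc k = -(gc k * W1 k)) ∧
    (∀ z : Cpp1 k, p1 k (W2 k) * z = z * p1 k (W2 k)) ∧
    ((∀ z : Cpp2 k, ∃ z' : Cpp2 k,
        p2 k (p1 k (W3 k)) * z = z' * p2 k (p1 k (W3 k))) ∧
      (∀ z : Cpp2 k, ∃ z' : Cpp2 k,
        z * p2 k (p1 k (W3 k)) = p2 k (p1 k (W3 k)) * z')) ∧
    (∃ f : CppQ k ≃ₐ[k] E3d k,
      f (RingQuot.mkAlgHom k (WRel k) (ga k)) =
        RingQuot.mkAlgHom k (E3dRel k) (ι k 1) + RingQuot.mkAlgHom k (E3dRel k) (ι k 2) ∧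
      f (RingQuot.mkAlgHom k (WRel k) (gb k)) =
        RingQuot.mkAlgHom k (E3dRel k) (ι k 1) - RingQuot.mkAlgHom k (E3dRel k) (ι k 2) ∧
      f (RingQuot.mkAlgHom k (WRel k) (gc k)) =
        RingQuot.mkAlgHom k (E3dRel k) (ι k 0)) := by
  let : Ring (Cpp2 k) := @RingQuot.instRing (Cpp1 k) inferInstance (WRel2 k)
  have s0 := RingQuot.mkAlgHom_surjective k (CppRel k)
  have s1 : Function.Surjective (p1 k) := RingQuot.mkAlgHom_surjective k (WRel1 k)
  have s2 : Function.Surjective (p2 k) := RingQuot.mkAlgHom_surjective k (WRel2 k)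
  have t1 : Function.Surjective ((p1 k).comp (RingQuot.mkAlgHom k (CppRel k))) := s1.comp s0
  have t2 : Function.Surjective
      (((p2 k).comp (p1 k)).comp (RingQuot.mkAlgHom k (CppRel k))) := (s2.comp s1).comp s0
  have a1 : W1 k * ga k = -(ga k * W1 k) := w1_a (cpp_h1 k) (cpp_h3 k)
  have b1 : W1 k * gb k = gb k * W1 k := w1_b (cpp_h2 k) (cpp_h4 k)
  have c1 : W1 k * gc k = -(gc k * W1 k) := w1_c (cpp_h1 k) (cpp_h2 k)
  have q1 : p1 k (W1 k) = 0 := quot_zero (WRel1.r (k := k))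
  refine ⟨⟨normal_left (A := Cpp k) _ s0 _ ?_, normal_right (A := Cpp k) _ s0 _ ?_, c1⟩, central_gen (A := Cpp1 k) _ t1 _ ?_,
    ⟨normal_left (A := Cpp2 k) _ t2 _ ?_, normal_right (A := Cpp2 k) _ t2 _ ?_⟩, ?_⟩
  · intro i
    fin_cases i
    · exact anti_left a1
    · exact ⟨gb k, b1⟩
    · exact anti_left c1
  · intro i
    fin_cases i
    · exact anti_right a1
    · exact ⟨gb k, b1.symm⟩
    · exact anti_right c1
  · have m1 := map_h1 k (B := Cpp1 k) (p1 k)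
    have m2 := map_h2 k (B := Cpp1 k) (p1 k)
    have m3 := map_h3 k (B := Cpp1 k) (p1 k)
    have m4 := map_h4 k (B := Cpp1 k) (p1 k)
    rw [map_W1 k (B := Cpp1 k)] at q1
    rw [map_W2 k (B := Cpp1 k)]
    intro i
    fin_cases i
    · exact w2_a m1 m4 q1
    · exact w2_b m2 m3
    · exact w2_c m1 m2
  all_goals try
    have m1 := map_h1 k ((p2 k).comp (p1 k))
    have m2 := map_h2 k ((p2 k).comp (p1 k))
    have m3 := map_h3 k ((p2 k).comp (p1 k))
    have m4 := map_h4 k ((p2 k).comp (p1 k))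
    have q2 : ((p2 k).comp (p1 k)) (W1 k) = 0 := by rw [AlgHom.comp_apply, q1, map_zero]
    rw [map_W1] at q2
    have e := map_W3 k ((p2 k).comp (p1 k))
    have a3 := w3_a m1 m3
    have b3 := w3_b m2 m4 q2
    have c3 := w3_c m1 m2
    rw [← e] at a3 b3 c3
  · intro i
    fin_cases i
    · exact anti_left a3
    · exact anti_left b3
    · exact anti_left c3
  · intro i
    fin_cases i
    · exact anti_right a3
    · exact anti_right b3
    · exact anti_right c3
  · obtain ⟨f, fa, fb, fc⟩ := exists_F k
    obtain ⟨g, gx, gy, gz⟩ := exists_G k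
    refine ⟨AlgEquiv.ofAlgHom f g ?_ ?_, fa, fb, fc⟩
    · apply RingQuot.ringQuot_ext'
      apply FreeAlgebra.hom_ext
      funext i
      fin_cases i
      · change f (g (RingQuot.mkAlgHom k (E3dRel k) (ι k 0))) = RingQuot.mkAlgHom k (E3dRel k) (ι k 0)
        rw [gx, fc]
      · change f (g (RingQuot.mkAlgHom k (E3dRel k) (ι k 1))) = RingQuot.mkAlgHom k (E3dRel k) (ι k 1)
        rw [gy, map_smul, map_add, fa, fb]
        module
      · change f (g (RingQuot.mkAlgHom k (E3dRel k) (ι k 2))) = RingQuot.mkAlgHom k (E3dRel k) (ι k 2)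
        rw [gz]
        exact alg_half_sub (A := CppQ k) (B := E3d k) f fa fb
    · apply RingQuot.ringQuot_ext'
      apply RingQuot.ringQuot_ext'
      apply FreeAlgebra.hom_ext
      funext i
      fin_cases i
      · change g (f (RingQuot.mkAlgHom k (WRel k) (ga k))) = RingQuot.mkAlgHom k (WRel k) (ga k)
        rw [fa, map_add, gy, gz]
        module
      · change g (f (RingQuot.mkAlgHom k (WRel k) (gb k))) = RingQuot.mkAlgHom k (WRel k) (gb k)
        rw [fb, map_sub, gy, gz]
        module
      · change g (f (RingQuot.mkAlgHom k (WRel k) (gc k))) = RingQuot.mkAlgHom k (WRel k) (gc k)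
        rw [fc, gx]

end
end
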